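/- There exists N such that for every odd integer k > 5 and every integer n ≥ N with n not congruent to 3, 5, 24, or 26 (mod 28), the number of isomorphism classes of cyclic (K_{2nk+k}, C_k)-designs satisfies NC(2nk+k, k) ≥ 2.49^n / k. -/

import Mathlib

namespace CCS

/-- A block: a set of edges of the complete graph on `ZMod v`. -/
abbrev Block (v : ℕ) := Finset (Sym2 (ZMod v))

/-- The edge set of the closed tuple `c = (c 0, c 1, …, c (k-1))`. -/
def edgesOf {v k : ℕ} (c : Fin k → ZMod v) : Block v :=
  Finset.image (fun i : Fin k => s(c i, c ⟨(i.1 + 1) % k, Nat.mod_lt _ i.pos⟩)) Finset.univ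

/-- `E` is the edge set of a `k`-cycle on `ZMod v`. Since for `k ≥ 3` the edge set
determines the closed tuple up to rotation and reversal, a `k`-cycle is identified
with its edge set. -/
def IsCycleBlock (v k : ℕ) (E : Block v) : Prop :=
  ∃ c : Fin k → ZMod v, Function.Injective c ∧ E = edgesOf c

/-- The translate `E + z` of a cycle. -/
def translateBlock {v : ℕ} (E : Block v) (z : ZMod v) : Block v :=
  E.image (Sym2.map (· + z))

/-- A `(K_v, C_k)`-design: a set of `k`-cycles whose edge sets partition the edges of `K_v`. -/
def IsDesign (v k : ℕ) (B : Set (Block v)) : Prop :=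
  (∀ E ∈ B, IsCycleBlock v k E) ∧
  ∀ e : Sym2 (ZMod v), ¬ e.IsDiag → ∃! E, E ∈ B ∧ e ∈ E

/-- A cyclic `(K_v, C_k)`-design. -/
def IsCyclicDesign (v k : ℕ) (B : Set (Block v)) : Prop :=
  IsDesign v k B ∧ ∀ E ∈ B, ∀ z : ZMod v, translateBlock E z ∈ B

/-- Two designs are isomorphic if a bijection of `ZMod v` maps one onto the other. -/
def Isomorphic {v : ℕ} (B B' : Set (Block v)) : Prop :=
  ∃ f : ZMod v ≃ ZMod v, B' = (fun E : Block v => E.image (Sym2.map f)) '' B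

/-- `NC v k`: the number of cyclic `(K_v, C_k)`-designs up to isomorphism. -/
noncomputable def NC (v k : ℕ) : ℕ :=
  Nat.card (Quot fun B B' : {B : Set (Block v) // IsCyclicDesign v k B} =>
    Isomorphic B.1 B'.1)

/-- The type of a cycle: the order of its stabilizer under translations. -/
noncomputable def cycleType {v : ℕ} (E : Block v) : ℕ :=
  Nat.card {z : ZMod v // translateBlock E z = E}

/-- The two differences `±(a-b)` arising from an edge `{a,b}`. -/
def edgeDiffs {v : ℕ} : Sym2 (ZMod v) → Multiset (ZMod v) :=
  Sym2.lift ⟨fun a b => {a - b, b - a}, fun a b => by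
    show (a-b) ::ₘ {b-a} = (b-a) ::ₘ {a-b}; exact Multiset.cons_swap _ _ _⟩

/-- The multiset of the `2k` differences arising from the `k` edges of a cycle.
For a cycle of type `d` this is `d` copies of the list `∂C` of partial differences. -/
def fullDiffs {v : ℕ} (E : Block v) : Multiset (ZMod v) :=
  E.val.bind edgeDiffs

/-- The multiset `∂C` of partial differences of a cycle: each difference is counted
with multiplicity equal to its multiplicity among the `2k` edge differences divided
by the type of the cycle. -/
noncomputable def partialDiffs {v : ℕ} (E : Block v) : Multiset (ZMod v) :=
  (fullDiffs E).toFinset.val.bind fun x =>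
    Multiset.replicate ((fullDiffs E).count x / cycleType E) x

/-- A `(K_v, C_k)`-difference system: a set of `k`-cycles whose partial differences
cover every nonzero element of `ZMod v` exactly once. -/
def IsDifferenceSystem (v k : ℕ) (F : Finset (Block v)) : Prop :=
  (∀ E ∈ F, IsCycleBlock v k E) ∧
  ∀ x : ZMod v, (F.val.bind partialDiffs).count x = if x = 0 then 0 else 1

end CCS

namespace CCS

/-- The image of a set of blocks under a permutation of the points. -/
def relabel {v : ℕ} (f : Equiv.Perm (ZMod v)) (B : Set (Block v)) : Set (Block v) :=
  (fun E : Block v => E.image (Sym2.map f)) '' B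

theorem relabel_one {v : ℕ} (B : Set (Block v)) : relabel 1 B = B := by
  have h : (fun E : Block v => E.image (Sym2.map (1 : Equiv.Perm (ZMod v)))) = id := by
    funext E
    simp only [Equiv.Perm.coe_one, Sym2.map_id, Finset.image_id, id]
  simp only [relabel, h, Set.image_id]

theorem relabel_mul {v : ℕ} (f g : Equiv.Perm (ZMod v)) (B : Set (Block v)) :
    relabel (f * g) B = relabel f (relabel g B) := by
  have h : (fun E : Block v => E.image (Sym2.map (f * g))) =
      (fun E : Block v => E.image (Sym2.map f)) ∘ fun E : Block v => E.image (Sym2.map g) := by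
    funext E
    simp only [Function.comp_apply, Finset.image_image, ← Sym2.map_comp, Equiv.Perm.coe_mul]
  simp only [relabel, h, Set.image_comp]

theorem relabel_addRight {v k : ℕ} {B : Set (Block v)} (hB : IsCyclicDesign v k B) :
    relabel (Equiv.addRight (1 : ZMod v)) B = B := by
  apply Set.Subset.antisymm
  · rintro _ ⟨E, hE, rfl⟩
    exact hB.2 E hE 1
  · intro E hE
    refine ⟨translateBlock E (-1), hB.2 E hE _, ?_⟩
    simp only [translateBlock, Finset.image_image, ← Sym2.map_comp]
    have h : (⇑(Equiv.addRight (1 : ZMod v)) ∘ fun x => x + -1) = id := by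
      funext x; simp
    rw [h, Sym2.map_id, Finset.image_id]

theorem isomorphic_equivalence (v : ℕ) : Equivalence (Isomorphic (v := v)) where
  refl B := ⟨1, (relabel_one B).symm⟩
  symm := by
    rintro B _ ⟨f, rfl⟩
    refine ⟨f⁻¹, ?_⟩
    change B = relabel f⁻¹ (relabel f B)
    rw [← relabel_mul, inv_mul_cancel, relabel_one]
  trans := by
    rintro B _ _ ⟨f, rfl⟩ ⟨g, rfl⟩
    exact ⟨g * f, (relabel_mul g f B).symm⟩

/-- A permutation conjugating `x ↦ x + 1` to a given permutation is determined by the preimage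
of `0`. -/
theorem perm_eq_of_conj_eq {v : ℕ} [NeZero v] {F G : Equiv.Perm (ZMod v)}
    (h0 : F⁻¹ 0 = G⁻¹ 0)
    (h : F⁻¹ * Equiv.addRight 1 * F = G⁻¹ * Equiv.addRight 1 * G) : F = G := by
  have key : ∀ a : ℕ, F⁻¹ (a : ZMod v) = G⁻¹ (a : ZMod v) := by
    intro a
    induction a with
    | zero => simpa using h0
    | succ a ih =>
      have h1 := DFunLike.congr_fun h (F⁻¹ (a : ZMod v))
      have h2 : F (F⁻¹ (a : ZMod v)) = a := F.apply_symm_apply _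
      have h3 : G (G⁻¹ (a : ZMod v)) = a := G.apply_symm_apply _
      simp only [Equiv.Perm.mul_apply, h2] at h1
      rw [ih, h3] at h1
      simpa using h1
  rw [← inv_inj]
  ext x
  rw [← ZMod.natCast_zmod_val x, key]

/-- At most `v` cyclic designs are isomorphic to a given one. -/
theorem card_isomorphic_le {v k : ℕ} [NeZero v] (B : Set (Block v)) :
    Nat.card {B' : Set (Block v) // IsCyclicDesign v k B' ∧ Isomorphic B B'} ≤ v := by
  classical
  set S := {B' : Set (Block v) // IsCyclicDesign v k B' ∧ Isomorphic B B'}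
  let H := {h : Equiv.Perm (ZMod v) // relabel h B = B}
  have hH : 0 < Nat.card H := Nat.card_pos_iff.2 ⟨⟨⟨1, relabel_one B⟩⟩, inferInstance⟩
  choose f hf using fun s : S => s.2.2
  have hf' : ∀ (s : S) (h : H), relabel (f s * h.1) B = s.1 := by
    intro s h
    rw [relabel_mul, h.2]
    exact (hf s).symm
  have hmem : ∀ (s : S) (h : H),
      relabel ((f s * h.1)⁻¹ * Equiv.addRight 1 * (f s * h.1)) B = B := by
    intro s h
    rw [relabel_mul, hf', relabel_mul, relabel_addRight s.2.1, ← hf' s h, ← relabel_mul,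
      inv_mul_cancel, relabel_one]
  let Φ : S × H → ZMod v × H := fun p =>
    ((f p.1 * p.2.1)⁻¹ 0, ⟨_, hmem p.1 p.2⟩)
  have hΦ : Function.Injective Φ := by
    rintro ⟨s, h⟩ ⟨s', h'⟩ heq
    have h1 := congrArg Prod.fst heq
    have h2 := congrArg (fun p => p.2.1) heq
    have h3 : f s * h.1 = f s' * h'.1 := perm_eq_of_conj_eq h1 h2
    have h4 : s = s' := by
      apply Subtype.ext
      rw [← hf' s h, ← hf' s' h', h3]
    subst h4
    simp only [Prod.mk.injEq, true_and]
    exact Subtype.ext (mul_left_cancel h3)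
  have h5 := Nat.card_le_card_of_injective Φ hΦ
  rw [Nat.card_prod, Nat.card_prod, Nat.card_zmod] at h5
  exact Nat.le_of_mul_le_mul_right h5 hH

theorem card_cyclicDesign_le (v k : ℕ) [NeZero v] :
    Nat.card {B : Set (Block v) // IsCyclicDesign v k B} ≤ v * NC v k := by
  classical
  have hequiv : Equivalence fun B B' : {B : Set (Block v) // IsCyclicDesign v k B} =>
      Isomorphic B.1 B'.1 := (isomorphic_equivalence v).comap Subtype.val
  have : Fintype {B : Set (Block v) // IsCyclicDesign v k B} := Fintype.ofFinite _
  unfold NC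
  have : Fintype (Quot fun B B' : {B : Set (Block v) // IsCyclicDesign v k B} =>
      Isomorphic B.1 B'.1) := Fintype.ofFinite _
  rw [Nat.card_eq_fintype_card, Nat.card_eq_fintype_card, ← Finset.card_univ]
  refine (Finset.card_le_mul_card_image (f := Quot.mk _) Finset.univ v ?_).trans
    (Nat.mul_le_mul_left _ (Finset.card_le_univ _))
  intro a _
  obtain ⟨B, rfl⟩ := Quot.exists_rep a
  refine le_trans ?_ (card_isomorphic_le (k := k) B.1)
  rw [← Fintype.card_subtype, ← Nat.card_eq_fintype_card]
  refine Nat.card_le_card_of_injective (fun x => ⟨x.1.1, x.1.2, ?_⟩) ?_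
  · exact hequiv.symm (hequiv.eqvGen_iff.1 (Quot.eqvGen_exact x.2))
  · intro x y h
    exact Subtype.ext (Subtype.ext (congrArg (fun z => z.1) h))

open Finset in
/-- The partial sums of the `ℓ`-periodic extension of a sequence of steps. -/
def walk {v : ℕ} (ℓ : ℕ) (step : ℕ → ZMod v) (j : ℕ) : ZMod v :=
  ∑ a ∈ range j, step (a % ℓ)

/-- The first `k` partial sums of the `ℓ`-periodic sequence `step` form a closed `k`-cycle. -/
structure IsClosedWalk (v k ℓ : ℕ) (step : ℕ → ZMod v) : Prop where
  pos : 0 < ℓ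
  dvd : ℓ ∣ k
  inj : Set.InjOn (walk ℓ step) (Set.Iio k)
  closed : walk ℓ step k = 0

section Walk

variable {v : ℕ} {ℓ : ℕ} {step : ℕ → ZMod v}

theorem walk_zero : walk ℓ step 0 = 0 := by simp [walk]

theorem walk_succ (j : ℕ) : walk ℓ step (j + 1) = walk ℓ step j + step (j % ℓ) :=
  Finset.sum_range_succ _ _

theorem walk_add_of_mod_eq {j j' : ℕ} (h : j % ℓ = j' % ℓ) (t : ℕ) :
    walk ℓ step (j + t) + walk ℓ step j' = walk ℓ step (j' + t) + walk ℓ step j := by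
  induction t with
  | zero => simp [add_comm]
  | succ t ih =>
    rw [← add_assoc, ← add_assoc, walk_succ, walk_succ, Nat.add_mod j, h, ← Nat.add_mod]
    linear_combination ih

theorem IsClosedWalk.walk_add {k : ℕ} (hw : IsClosedWalk v k ℓ step)
    (j : ℕ) : walk ℓ step (j + k) = walk ℓ step j := by
  have h := walk_add_of_mod_eq (step := step) (ℓ := ℓ) (j := k) (j' := 0)
    (by rw [Nat.zero_mod, Nat.mod_eq_zero_of_dvd hw.dvd]) j
  rw [hw.closed, walk_zero, add_zero, add_zero, zero_add] at h
  rw [add_comm, h]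

theorem IsClosedWalk.walk_add_mul {k : ℕ} (hw : IsClosedWalk v k ℓ step)
    (j q : ℕ) : walk ℓ step (j + k * q) = walk ℓ step j := by
  induction q with
  | zero => simp
  | succ q ih => rw [mul_add, mul_one, ← add_assoc, hw.walk_add, ih]

theorem IsClosedWalk.walk_mod {k : ℕ} (hw : IsClosedWalk v k ℓ step)
    (j : ℕ) : walk ℓ step (j % k) = walk ℓ step j := by
  conv_rhs => rw [← Nat.mod_add_div j k, hw.walk_add_mul]

end Walk

/-- The cycle traced by a walk of length `k`. -/
def walkBlock {v : ℕ} (k ℓ : ℕ) (step : ℕ → ZMod v) : Block v :=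
  edgesOf fun j : Fin k => walk ℓ step j

theorem IsClosedWalk.mem_translateBlock {v k ℓ : ℕ} {step : ℕ → ZMod v} (hk : 0 < k)
    (hw : IsClosedWalk v k ℓ step) (z : ZMod v) (e : Sym2 (ZMod v)) :
    e ∈ translateBlock (walkBlock k ℓ step) z ↔
      ∃ j : ℕ, e = s(walk ℓ step j + z, walk ℓ step j + z + step (j % ℓ)) := by
  simp only [translateBlock, walkBlock, edgesOf, Finset.mem_image, Finset.mem_univ, true_and,
    exists_exists_eq_and, Sym2.map_mk]
  constructor
  · rintro ⟨j, rfl⟩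
    refine ⟨j, ?_⟩
    rw [hw.walk_mod, walk_succ]
    rw [add_right_comm]
  · rintro ⟨j, rfl⟩
    refine ⟨⟨j % k, Nat.mod_lt _ hk⟩, ?_⟩
    simp only
    rw [hw.walk_mod, hw.walk_mod, walk_succ, hw.walk_mod, Nat.mod_mod_of_dvd _ hw.dvd]
    rw [add_right_comm]

theorem IsClosedWalk.translateBlock_subset {v k ℓ : ℕ} {step : ℕ → ZMod v} (hk : 0 < k)
    (hw : IsClosedWalk v k ℓ step) {z z' : ZMod v} {j j' : ℕ} (h : j % ℓ = j' % ℓ)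
    (hz : walk ℓ step j + z = walk ℓ step j' + z') :
    translateBlock (walkBlock k ℓ step) z ⊆ translateBlock (walkBlock k ℓ step) z' := by
  intro e he
  rw [hw.mem_translateBlock hk] at he ⊢
  obtain ⟨a, rfl⟩ := he
  have hj : j + (a + j * (k - 1)) = a + k * j := by
    obtain ⟨k, rfl⟩ := Nat.exists_eq_succ_of_ne_zero hk.ne'
    simp only [Nat.succ_eq_add_one, Nat.add_sub_cancel]; ring
  have h1 := walk_add_of_mod_eq (step := step) h (a + j * (k - 1))
  rw [hj, hw.walk_add_mul] at h1
  have hmod : (j' + (a + j * (k - 1))) % ℓ = a % ℓ := by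
    rw [Nat.add_mod, ← h, ← Nat.add_mod, hj]
    obtain ⟨d, rfl⟩ := hw.dvd
    rw [mul_assoc, Nat.add_mul_mod_self_left]
  refine ⟨j' + (a + j * (k - 1)), ?_⟩
  rw [hmod]
  have h2 : walk ℓ step a + z = walk ℓ step (j' + (a + j * (k - 1))) + z' := by
    linear_combination h1 + hz
  rw [h2]

theorem IsClosedWalk.translateBlock_eq {v k ℓ : ℕ} {step : ℕ → ZMod v} (hk : 0 < k)
    (hw : IsClosedWalk v k ℓ step) {z z' : ZMod v} {j j' : ℕ} (h : j % ℓ = j' % ℓ)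
    (hz : walk ℓ step j + z = walk ℓ step j' + z') :
    translateBlock (walkBlock k ℓ step) z = translateBlock (walkBlock k ℓ step) z' :=
  (hw.translateBlock_subset hk h hz).antisymm (hw.translateBlock_subset hk h.symm hz.symm)

/-- A system of closed walks whose steps, up to sign, cover the nonzero elements of `ZMod v`
exactly once. -/
structure IsWalkSystem {ι : Type*} [Fintype ι] (v k : ℕ) (ℓ : ι → ℕ) (step : ι → ℕ → ZMod v) :
    Prop where
  closedWalk : ∀ i, IsClosedWalk v k (ℓ i) (step i)
  cover : ∀ x : ZMod v, x ≠ 0 → ∃ i, ∃ l < ℓ i, x = step i l ∨ x = -step i l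
  total : 2 * ∑ i, ℓ i + 1 = v

/-- All translates of the cycles of a system of walks. -/
def walkDesign {ι : Type*} {v : ℕ} (k : ℕ) (ℓ : ι → ℕ) (step : ι → ℕ → ZMod v) :
    Set (Block v) :=
  {E | ∃ i z, E = translateBlock (walkBlock k (ℓ i) (step i)) z}

/-- Two differences occur in a common block. -/
def Linked {v : ℕ} (B : Set (Block v)) (δ δ' : ZMod v) : Prop :=
  ∃ E ∈ B, ∃ x y, s(x, x + δ) ∈ E ∧ s(y, y + δ') ∈ E

section System

variable {ι : Type*} [Fintype ι] {v k : ℕ} {ℓ : ι → ℕ} {step : ι → ℕ → ZMod v}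

theorem IsWalkSystem.signed_injective (hS : IsWalkSystem v k ℓ step) :
    Function.Injective fun p : (Σ i, Fin (ℓ i)) × Bool =>
      bif p.2 then step p.1.1 p.1.2 else -step p.1.1 p.1.2 := by
  classical
  have hv : NeZero v := ⟨by have := hS.total; omega⟩
  set Φ := fun p : (Σ i, Fin (ℓ i)) × Bool =>
      bif p.2 then step p.1.1 p.1.2 else -step p.1.1 p.1.2
  have hsub : Finset.univ.erase 0 ⊆ Finset.univ.image Φ := by
    intro x hx
    obtain ⟨i, l, hl, h⟩ := hS.cover x (Finset.ne_of_mem_erase hx)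
    rcases h with h | h
    · exact Finset.mem_image.2 ⟨(⟨i, ⟨l, hl⟩⟩, true), Finset.mem_univ _, h.symm⟩
    · exact Finset.mem_image.2 ⟨(⟨i, ⟨l, hl⟩⟩, false), Finset.mem_univ _, h.symm⟩
  have h1 := Finset.card_le_card hsub
  rw [Finset.card_erase_of_mem (Finset.mem_univ _), Finset.card_univ, ZMod.card] at h1
  have h2 : Fintype.card ((Σ i, Fin (ℓ i)) × Bool) = v - 1 := by
    have := hS.total
    simp only [Fintype.card_prod, Fintype.card_sigma, Fintype.card_fin, Fintype.card_bool]
    omega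
  rw [← Finset.card_univ] at h2
  have h3 := Finset.card_image_iff.1 (le_antisymm Finset.card_image_le (h2 ▸ h1))
  exact Set.injOn_univ.1 (by simpa using h3)

theorem IsWalkSystem.eq_of_step (hS : IsWalkSystem v k ℓ step) {i i' : ι} {l l' : ℕ}
    (hl : l < ℓ i) (hl' : l' < ℓ i') :
    step i l ≠ -step i' l' ∧ (step i l = step i' l' → i = i' ∧ l = l') := by
  constructor
  · intro h
    have := hS.signed_injective (a₁ := (⟨i, ⟨l, hl⟩⟩, true)) (a₂ := (⟨i', ⟨l', hl'⟩⟩, false)) h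
    simp at this
  · intro h
    have := hS.signed_injective (a₁ := (⟨i, ⟨l, hl⟩⟩, true)) (a₂ := (⟨i', ⟨l', hl'⟩⟩, true)) h
    simp only [Prod.mk.injEq, and_true] at this
    injection this with h1 h2
    subst h1
    simpa using h2

theorem IsWalkSystem.isCyclicDesign (hk : 0 < k) (hS : IsWalkSystem v k ℓ step) :
    IsCyclicDesign v k (walkDesign k ℓ step) := by
  refine ⟨⟨?_, ?_⟩, ?_⟩
  · rintro _ ⟨i, z, rfl⟩
    refine ⟨fun j => walk (ℓ i) (step i) j + z, ?_, ?_⟩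
    · intro a b h
      exact Fin.ext ((hS.closedWalk i).inj a.2 b.2 (add_right_cancel h))
    · simp only [translateBlock, walkBlock, edgesOf, Finset.image_image]
      rfl
  · intro e
    induction e using Sym2.ind with
    | _ a b =>
    intro hab
    rw [Sym2.mk_isDiag_iff] at hab
    obtain ⟨i, l, hl, h⟩ := hS.cover (b - a) (sub_ne_zero.2 (Ne.symm hab))
    have hex : ∃ i l, ∃ z, l < ℓ i ∧
        s(a, b) = s(walk (ℓ i) (step i) l + z, walk (ℓ i) (step i) l + z + step i l) := by
      rcases h with h | h
      · refine ⟨i, l, a - walk (ℓ i) (step i) l, hl, ?_⟩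
        rw [← h]
        congr 2 <;> ring
      · refine ⟨i, l, b - walk (ℓ i) (step i) l, hl, ?_⟩
        rw [Sym2.eq_swap, ← neg_eq_iff_eq_neg.2 h]
        congr 2 <;> ring
    clear h hl i l
    obtain ⟨i, l, z, hl, he⟩ := hex
    rw [he]
    refine ⟨translateBlock (walkBlock k (ℓ i) (step i)) z, ⟨⟨i, z, rfl⟩, ?_⟩, ?_⟩
    · rw [(hS.closedWalk i).mem_translateBlock hk]
      exact ⟨l, by rw [Nat.mod_eq_of_lt hl]⟩
    · rintro _ ⟨⟨i', z', rfl⟩, hmem⟩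
      rw [(hS.closedWalk i').mem_translateBlock hk] at hmem
      obtain ⟨j, hj⟩ := hmem
      have hj' : j % ℓ i' < ℓ i' := Nat.mod_lt _ (hS.closedWalk i').pos
      rw [Sym2.eq_iff] at hj
      have hE := hS.eq_of_step hl hj'
      rcases hj with ⟨h1, h2⟩ | ⟨h1, h2⟩
      · rw [h1] at h2
        obtain ⟨rfl, h3⟩ := hE.2 (add_left_cancel h2)
        refine (hS.closedWalk i).translateBlock_eq hk (j := j) (j' := l) ?_ h1.symm
        rw [Nat.mod_eq_of_lt hl]
        exact h3.symm
      · exact absurd (by linear_combination h2 - h1) hE.1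
  · rintro _ ⟨i, z, rfl⟩ z'
    refine ⟨i, z + z', ?_⟩
    simp only [translateBlock, Finset.image_image, ← Sym2.map_comp]
    congr 2
    funext x
    simp [add_assoc]

theorem IsWalkSystem.eq_of_edge_mem (hk : 0 < k) (hS : IsWalkSystem v k ℓ step) {i i' : ι}
    {l : ℕ} (hl : l < ℓ i) {x z δ : ZMod v} (hδ : δ = step i l ∨ δ = -step i l)
    (h : s(x, x + δ) ∈ translateBlock (walkBlock k (ℓ i') (step i')) z) : i = i' := by
  rw [(hS.closedWalk i').mem_translateBlock hk] at h
  obtain ⟨j, hj⟩ := h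
  have hE := hS.eq_of_step hl (Nat.mod_lt j (hS.closedWalk i').pos)
  rw [Sym2.eq_iff] at hj
  rcases hj with ⟨h1, h2⟩ | ⟨h1, h2⟩ <;> rw [h1] at h2
  · rcases hδ with rfl | rfl
    · exact (hE.2 (add_left_cancel h2)).1
    · exact absurd (by linear_combination -h2) hE.1
  · rcases hδ with rfl | rfl
    · exact absurd (by linear_combination h2) hE.1
    · exact (hE.2 (by linear_combination -h2)).1

theorem IsWalkSystem.linked_iff (hk : 0 < k) (hS : IsWalkSystem v k ℓ step) {i i' : ι} {l l' : ℕ}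
    (hl : l < ℓ i) (hl' : l' < ℓ i') {δ δ' : ZMod v} (hδ : δ = step i l ∨ δ = -step i l)
    (hδ' : δ' = step i' l' ∨ δ' = -step i' l') :
    Linked (walkDesign k ℓ step) δ δ' ↔ i = i' := by
  constructor
  · rintro ⟨_, ⟨a, z, rfl⟩, x, y, hx, hy⟩
    rw [hS.eq_of_edge_mem hk hl hδ hx, hS.eq_of_edge_mem hk hl' hδ' hy]
  · rintro rfl
    have key : ∀ {l} {δ : ZMod v}, l < ℓ i → (δ = step i l ∨ δ = -step i l) →
        ∃ x, s(x, x + δ) ∈ translateBlock (walkBlock k (ℓ i) (step i)) 0 := by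
      intro l δ hl hδ
      simp only [(hS.closedWalk i).mem_translateBlock hk]
      rcases hδ with rfl | rfl
      · exact ⟨walk (ℓ i) (step i) l, l, by rw [Nat.mod_eq_of_lt hl, add_zero]⟩
      · refine ⟨walk (ℓ i) (step i) l + step i l, l, ?_⟩
        rw [Nat.mod_eq_of_lt hl, Sym2.eq_swap, add_neg_cancel_right, add_zero]
    obtain ⟨x, hx⟩ := key hl hδ
    obtain ⟨y, hy⟩ := key hl' hδ'
    exact ⟨_, ⟨i, 0, rfl⟩, x, y, hx, hy⟩

end System

open Finset in
/-- Conditions on the integer steps `X l + Y l * m` for tracing a closed `k`-cycle modulo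
`m * k`. -/
structure IsBaseWalk (m k ℓ : ℕ) (X Y : ℕ → ℤ) : Prop where
  pos : 0 < ℓ
  dvd : ℓ ∣ k
  sum_fst : ∑ a ∈ range ℓ, X a = 0
  sum_snd : (k : ℤ) ∣ (k / ℓ : ℕ) * ∑ a ∈ range ℓ, Y a
  fst_eq : ∀ j < ℓ, ∀ j' < ℓ, (m : ℤ) ∣ ∑ a ∈ range j, X a - ∑ a ∈ range j', X a →
    ∑ a ∈ range j, X a = ∑ a ∈ range j', X a
  snd_inj : ∀ j < ℓ, ∀ j' < ℓ, ∑ a ∈ range j, X a = ∑ a ∈ range j', X a →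
    ∀ b < k / ℓ, ∀ b' < k / ℓ,
      (k : ℤ) ∣ (∑ a ∈ range j, Y a + b * ∑ a ∈ range ℓ, Y a) -
        (∑ a ∈ range j', Y a + b' * ∑ a ∈ range ℓ, Y a) → j = j' ∧ b = b'

/-- The steps `X l + Y l * m` modulo `v`. -/
def intStep (v m : ℕ) (X Y : ℕ → ℤ) (l : ℕ) : ZMod v := ((X l + Y l * m : ℤ) : ZMod v)

theorem walk_mul_add {v ℓ : ℕ} {step : ℕ → ZMod v} (q r : ℕ) :
    walk ℓ step (ℓ * q + r) = q * walk ℓ step ℓ + walk ℓ step r := by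
  have h (q r : ℕ) : walk ℓ step (ℓ * q + r) = walk ℓ step (ℓ * q) + walk ℓ step r := by
    have := walk_add_of_mod_eq (step := step) (j := ℓ * q) (j' := 0) (ℓ := ℓ) (by simp) r
    rw [walk_zero, add_zero, zero_add] at this
    rw [this, add_comm]
  rw [h]
  congr 1
  induction q with
  | zero => simp [walk_zero]
  | succ q ih => rw [mul_add, mul_one, h, ih]; push_cast; ring

open Finset in
theorem walk_intStep {v m ℓ : ℕ} {X Y : ℕ → ℤ} {r : ℕ} (hr : r ≤ ℓ) :
    walk ℓ (intStep v m X Y) r = ((∑ a ∈ range r, X a + (∑ a ∈ range r, Y a) * m : ℤ) : ZMod v) := by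
  rw [walk, sum_mul, ← sum_add_distrib, Int.cast_sum]
  refine sum_congr rfl fun a ha => ?_
  rw [Nat.mod_eq_of_lt ((mem_range.1 ha).trans_le hr), intStep]

theorem IsBaseWalk.isClosedWalk {v m k ℓ : ℕ} {X Y : ℕ → ℤ} (hv : v = m * k) (hm : 0 < m)
    (h : IsBaseWalk m k ℓ X Y) : IsClosedWalk v k ℓ (intStep v m X Y) := by
  have hwalk : ∀ j, walk ℓ (intStep v m X Y) j =
      ((∑ a ∈ Finset.range (j % ℓ), X a + (∑ a ∈ Finset.range (j % ℓ), Y a +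
        (j / ℓ : ℕ) * ∑ a ∈ Finset.range ℓ, Y a) * m : ℤ) : ZMod v) := by
    intro j
    conv_lhs => rw [← Nat.div_add_mod j ℓ]
    rw [walk_mul_add, walk_intStep le_rfl, walk_intStep (Nat.mod_lt _ h.pos).le, h.sum_fst]
    generalize j / ℓ = d
    push_cast
    ring
  refine ⟨h.pos, h.dvd, ?_, ?_⟩
  · intro j hj j' hj' heq
    simp only [Set.mem_Iio] at hj hj'
    rw [hwalk, hwalk, ← sub_eq_zero, ← Int.cast_sub, ZMod.intCast_zmod_eq_zero_iff_dvd, hv] at heq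
    push_cast at heq
    have hmod := Nat.mod_lt j h.pos
    have hmod' := Nat.mod_lt j' h.pos
    have h1 : (m : ℤ) ∣ ∑ a ∈ Finset.range (j % ℓ), X a - ∑ a ∈ Finset.range (j' % ℓ), X a := by
      refine (Int.dvd_add_left (dvd_mul_left (m : ℤ)
        ((∑ a ∈ Finset.range (j % ℓ), Y a + (j / ℓ : ℕ) * ∑ a ∈ Finset.range ℓ, Y a) -
          (∑ a ∈ Finset.range (j' % ℓ), Y a + (j' / ℓ : ℕ) * ∑ a ∈ Finset.range ℓ, Y a)))).1
        ((dvd_mul_right _ _).trans (heq.trans (dvd_of_eq ?_)))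
      push_cast
      ring
    have h2 := h.fst_eq _ hmod _ hmod' h1
    have hb : ∀ {j}, j < k → j / ℓ < k / ℓ := fun {j} hj =>
      Nat.div_lt_div_of_lt_of_dvd h.dvd hj
    have h3 := h.snd_inj _ hmod _ hmod' h2 _ (hb hj) _ (hb hj') (by
      rw [h2] at heq
      refine Int.dvd_of_mul_dvd_mul_left (a := (m : ℤ)) (by positivity) (heq.trans ?_)
      apply dvd_of_eq; push_cast; ring)
    rw [← Nat.div_add_mod j ℓ, ← Nat.div_add_mod j' ℓ, h3.1, h3.2]
  · rw [hwalk, Nat.mod_eq_zero_of_dvd h.dvd, ZMod.intCast_zmod_eq_zero_iff_dvd, hv]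
    obtain ⟨c, hc⟩ := h.sum_snd
    refine ⟨c, ?_⟩
    simp only [Finset.range_zero, Finset.sum_empty, zero_add]
    rw [hc]
    push_cast
    ring

section Zigzag

open Finset

variable {X Y : ℕ → ℤ} {x t : ℤ} {Δ K : ℕ}

/-- The partial sums of an alternating sequence of steps. -/
theorem sum_zigzag (hX : ∀ l < K, X l = (-1) ^ l * x) (hΔ : Even Δ)
    (hY : ∀ l < K, Y l = (-1) ^ l * (t + l - if l < Δ then 1 else 0)) (a : ℕ) :
    (2 * a ≤ K → ∑ l ∈ range (2 * a), X l = 0 ∧ ∑ l ∈ range (2 * a), Y l = -a) ∧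
    (2 * a + 1 ≤ K → ∑ l ∈ range (2 * a + 1), X l = x ∧
      ∑ l ∈ range (2 * a + 1), Y l = t + a - if 2 * a < Δ then 1 else 0) := by
  have step (a : ℕ) (ih : 2 * a ≤ K →
      ∑ l ∈ range (2 * a), X l = 0 ∧ ∑ l ∈ range (2 * a), Y l = -a) (h : 2 * a + 1 ≤ K) :
      ∑ l ∈ range (2 * a + 1), X l = x ∧
        ∑ l ∈ range (2 * a + 1), Y l = t + a - if 2 * a < Δ then 1 else 0 := by
    obtain ⟨h1, h2⟩ := ih (by omega)
    rw [sum_range_succ, sum_range_succ, h1, h2, hX _ (by omega), hY _ (by omega)]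
    simp only [pow_mul, neg_one_sq, one_pow]
    push_cast
    constructor <;> ring
  induction a with
  | zero => exact ⟨by simp, step 0 (by simp)⟩
  | succ a ih =>
    have h0 : 2 * (a + 1) ≤ K → ∑ l ∈ range (2 * (a + 1)), X l = 0 ∧
        ∑ l ∈ range (2 * (a + 1)), Y l = -((a + 1 : ℕ) : ℤ) := by
      intro h
      obtain ⟨h1, h2⟩ := ih.2 (by omega)
      rw [show 2 * (a + 1) = 2 * a + 1 + 1 by ring, sum_range_succ _ (2 * a + 1),
        sum_range_succ _ (2 * a + 1), h1, h2,
        hX _ (by omega), hY _ (by omega)]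
      have : 2 * a + 1 < Δ ↔ 2 * a < Δ := by
        obtain ⟨d, rfl⟩ := hΔ; omega
      simp only [pow_succ, pow_mul, this]
      push_cast
      constructor <;> ring
    exact ⟨h0, step _ h0⟩

/-- An alternating sequence of an odd number of steps, followed by steps through vertices away from
it, is a base walk. -/
theorem isBaseWalk_of_zigzag {m k : ℕ} (hX : ∀ l < K, X l = (-1) ^ l * x) (hΔ : Even Δ)
    (hY : ∀ l < K, Y l = (-1) ^ l * (t + l - if l < Δ then 1 else 0))
    (hK : K < k) (hx : ¬(m : ℤ) ∣ x)
    (hXk : ∑ a ∈ range k, X a = 0) (hYk : (k : ℤ) ∣ ∑ a ∈ range k, Y a)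
    (htail : ∀ j, K < j → j < k →
      ¬(m : ℤ) ∣ ∑ a ∈ range j, X a ∧ ¬(m : ℤ) ∣ ∑ a ∈ range j, X a - x)
    (htail' : ∀ j j', K < j → j < j' → j' < k →
      ¬(m : ℤ) ∣ ∑ a ∈ range j', X a - ∑ a ∈ range j, X a ∨
      ∑ a ∈ range j', X a = ∑ a ∈ range j, X a ∧
        ¬(k : ℤ) ∣ ∑ a ∈ range j', Y a - ∑ a ∈ range j, Y a) :
    IsBaseWalk m k k X Y := by
  have hx0 : x ≠ 0 := by rintro rfl; simp at hx
  have key : ∀ j j', j < j' → j' < k →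
      ¬(m : ℤ) ∣ ∑ a ∈ range j', X a - ∑ a ∈ range j, X a ∨
      ∑ a ∈ range j', X a = ∑ a ∈ range j, X a ∧
        ¬(k : ℤ) ∣ ∑ a ∈ range j', Y a - ∑ a ∈ range j, Y a := by
    intro j j' hjj' hj'
    have hz := sum_zigzag hX hΔ hY
    rcases le_or_gt j K with hj | hj
    · rcases le_or_gt j' K with hjK | hjK
      · obtain ⟨a, rfl | rfl⟩ := Nat.even_or_odd' j <;> obtain ⟨b, rfl | rfl⟩ := Nat.even_or_odd' j'
        · rw [((hz a).1 hj).1, ((hz a).1 hj).2, ((hz b).1 hjK).1, ((hz b).1 hjK).2]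
          refine .inr ⟨rfl, fun h => ?_⟩
          have := Int.eq_zero_of_abs_lt_dvd h (by rw [abs_lt]; omega)
          omega
        · rw [((hz a).1 hj).1, ((hz b).2 hjK).1, sub_zero]
          exact .inl hx
        · rw [((hz a).2 hj).1, ((hz b).1 hjK).1, zero_sub, dvd_neg]
          exact .inl hx
        · rw [((hz a).2 hj).1, ((hz a).2 hj).2, ((hz b).2 hjK).1, ((hz b).2 hjK).2]
          refine .inr ⟨rfl, fun h => ?_⟩
          have := Int.eq_zero_of_abs_lt_dvd h (by rw [abs_lt]; split_ifs <;> omega)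
          revert this
          split_ifs <;> omega
      · left
        obtain ⟨h1, h2⟩ := htail j' hjK hj'
        obtain ⟨a, rfl | rfl⟩ := Nat.even_or_odd' j
        · rwa [((hz a).1 hj).1, sub_zero]
        · rwa [((hz a).2 hj).1]
    · exact htail' j j' hj hjj' hj'
  have hk : 0 < k := by omega
  refine ⟨hk, dvd_rfl, hXk, ?_, ?_, ?_⟩
  · rw [Nat.div_self hk, Nat.cast_one, one_mul]
    exact hYk
  · intro j hj j' hj' h
    rcases lt_trichotomy j j' with hlt | rfl | hlt
    · rcases key j j' hlt hj' with h1 | h1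
      · exact absurd (by rwa [dvd_sub_comm]) h1
      · exact h1.1.symm
    · rfl
    · rcases key j' j hlt hj with h1 | h1
      · exact absurd h h1
      · exact h1.1
  · intro j hj j' hj' heq b hb b' hb' h
    rw [Nat.div_self hk, Nat.lt_one_iff] at hb hb'
    subst hb hb'
    simp only [Nat.cast_zero, zero_mul, add_zero] at h
    refine ⟨?_, rfl⟩
    rcases lt_trichotomy j j' with hlt | rfl | hlt
    · rcases key j j' hlt hj' with h1 | h1
      · exact absurd (by simp [heq]) h1
      · exact absurd (by rwa [dvd_sub_comm]) h1.2
    · rfl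
    · rcases key j' j hlt hj with h1 | h1
      · exact absurd (by simp [heq]) h1
      · exact absurd h h1.2

/-- A base walk of length `ℓ` with one alternating run. -/
theorem isBaseWalk_of_zigzag_short {m k p ℓ : ℕ} {z : ℕ} (hp : p.Prime) (hk : k = ℓ * p)
    (hℓ : Odd ℓ)
    (hX : ∀ l < ℓ - 1, X l = (-1) ^ l * x)
    (hY : ∀ l < ℓ - 1, Y l = (-1) ^ l * (t + l))
    (hXl : X (ℓ - 1) = 0) (hYl : Y (ℓ - 1) = ((ℓ - 1) / 2 : ℕ) + z * ℓ) (hz : 0 < z) (hzp : z < p)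
    (hx : ¬(m : ℤ) ∣ x) :
    IsBaseWalk m k ℓ X Y := by
  obtain ⟨h, rfl⟩ := hℓ
  rw [Nat.add_sub_cancel] at *
  have hzz := sum_zigzag (Δ := 0) (K := 2 * h) hX (by simp) (by simpa using hY)
  have hP : ∑ l ∈ range (2 * h + 1), Y l = z * (2 * h + 1 : ℕ) := by
    rw [sum_range_succ, ((hzz h).1 le_rfl).2, hYl, Nat.mul_div_cancel_left _ two_pos]
    ring
  have hkdiv : k / (2 * h + 1) = p := by
    rw [hk, Nat.mul_div_cancel_left _ (by omega)]
  refine ⟨by omega, ⟨p, hk⟩, ?_, ?_, ?_, ?_⟩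
  · rw [sum_range_succ, ((hzz h).1 le_rfl).1, hXl, add_zero]
  · rw [hkdiv, hP, hk]
    exact ⟨z, by push_cast; ring⟩
  · intro j hj j' hj' hd
    obtain ⟨a, rfl | rfl⟩ := Nat.even_or_odd' j <;> obtain ⟨b, rfl | rfl⟩ := Nat.even_or_odd' j'
    · rw [((hzz a).1 (by omega)).1, ((hzz b).1 (by omega)).1]
    · rw [((hzz a).1 (by omega)).1, ((hzz b).2 (by omega)).1, zero_sub, dvd_neg] at hd
      exact absurd hd hx
    · rw [((hzz a).2 (by omega)).1, ((hzz b).1 (by omega)).1, sub_zero] at hd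
      exact absurd hd hx
    · rw [((hzz a).2 (by omega)).1, ((hzz b).2 (by omega)).1]
  · have hx0 : x ≠ 0 := by rintro rfl; simp at hx
    have fin : ∀ (b b' : ℕ), b < p → b' < p → ∀ c : ℤ, |c| < (2 * h + 1 : ℕ) →
        (k : ℤ) ∣ c + (b - b') * (z * (2 * h + 1 : ℕ)) → c = 0 ∧ b = b' := by
      intro b b' hb hb' c hc hd
      rw [hk] at hd
      have hc0 : c = 0 := by
        refine Int.eq_zero_of_abs_lt_dvd (m := ((2 * h + 1 : ℕ) : ℤ)) ?_ hc
        refine (Int.dvd_add_left (c := (b - b') * (z * (2 * h + 1 : ℕ))) ⟨(b - b') * z, by ring⟩).1 ?_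
        exact (Dvd.intro (p : ℤ) (by push_cast; ring)).trans hd
      refine ⟨hc0, ?_⟩
      rw [hc0, zero_add] at hd
      have h1 : (p : ℤ) ∣ (b - b') * z := by
        refine Int.dvd_of_mul_dvd_mul_left (a := ((2 * h + 1 : ℕ) : ℤ)) (by positivity) ?_
        refine (dvd_of_eq (by push_cast; ring)).trans (hd.trans (dvd_of_eq (by ring)))
      rcases (Nat.prime_iff_prime_int.1 hp).dvd_or_dvd h1 with h2 | h2
      · have := Int.eq_zero_of_abs_lt_dvd h2 (by rw [abs_lt]; omega)
        omega
      · have := Int.eq_zero_of_abs_lt_dvd h2 (by rw [abs_lt]; omega)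
        omega
    intro j hj j' hj' heq b hb b' hb' hd
    rw [hkdiv] at hb hb'
    rw [hP] at hd
    obtain ⟨a, rfl | rfl⟩ := Nat.even_or_odd' j <;> obtain ⟨c, rfl | rfl⟩ := Nat.even_or_odd' j'
    · rw [((hzz a).1 (by omega)).2, ((hzz c).1 (by omega)).2] at hd
      have := fin b b' hb hb' (c - a) (by rw [abs_lt]; omega) (by convert hd using 1; ring)
      omega
    · rw [((hzz a).1 (by omega)).1, ((hzz c).2 (by omega)).1] at heq
      exact absurd heq.symm hx0
    · rw [((hzz a).2 (by omega)).1, ((hzz c).1 (by omega)).1] at heq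
      exact absurd heq hx0
    · rw [((hzz a).2 (by omega)).2, ((hzz c).2 (by omega)).2] at hd
      have := fin b b' hb hb' (a - c) (by rw [abs_lt]; omega)
        (by convert hd using 1; simp only [not_lt_zero, if_false]; ring)
      omega

end Zigzag

open Finset

/-- A cyclic arrangement of `s` residues modulo `m` with vanishing sum and no other vanishing sum
of consecutive terms. -/
structure IsZeroSumCycle (m s : ℕ) (R : ℕ → ℤ) : Prop where
  periodic : ∀ c, R (c + s) = R c
  sum_eq_zero : ∑ c ∈ range s, R c = 0
  consecutive : ∀ i r, 0 < r → r < s → ¬(m : ℤ) ∣ ∑ q ∈ range r, R (i + q)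

theorem sum_range_add_of_periodic {s : ℕ} {f : ℕ → ℤ} (hf : ∀ c, f (c + s) = f c) (i : ℕ) :
    ∑ q ∈ range s, f (i + q) = ∑ q ∈ range s, f q := by
  induction i with
  | zero => simp
  | succ i ih =>
    rw [← ih]
    have h1 := sum_range_succ (fun q => f (i + q)) s
    rw [sum_range_succ', hf, add_zero] at h1
    rw [← add_left_inj (f i), ← h1]
    congr 1
    exact sum_congr rfl fun q _ => by rw [add_assoc, add_comm 1]

/-- The residues modulo `m` of the steps of the `i`-th walk attached to a zero-sum cycle. -/
def groupX (k s : ℕ) (R : ℕ → ℤ) (i l : ℕ) : ℤ :=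
  if l ≤ k - s then (-1) ^ l * R i else R (i + (l - (k - s)))

/-- The multiples of `m` in the steps of the `i`-th walk attached to a zero-sum cycle. -/
def groupY (k s : ℕ) (t : ℕ → ℤ) (i l : ℕ) : ℤ :=
  if l ≤ k - s then (-1) ^ l * (t i + l) else t (i + (l - (k - s))) + l

theorem isBaseWalk_group {m k s : ℕ} {R t : ℕ → ℤ} (hk : Odd k) (hs : Odd s) (hs1 : 1 < s)
    (hsk : s < k) (hR : IsZeroSumCycle m s R) (ht : ∀ c, t (c + s) = t c)
    (hts : 2 * ∑ c ∈ range s, t c = s * (s - 1) - (k - s)) (i : ℕ) :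
    IsBaseWalk m k k (groupX k s R i) (groupY k s t i) := by
  obtain ⟨d, hd⟩ : ∃ d, k = s + 2 * d := by
    obtain ⟨a, rfl⟩ := hk
    obtain ⟨b, rfl⟩ := hs
    exact ⟨a - b, by omega⟩
  have hks : k - s = 2 * d := by omega
  have hX : ∀ l < 2 * d + 1, groupX k s R i l = (-1) ^ l * R i := fun l hl => by
    rw [groupX, if_pos (by omega)]
  have hY : ∀ l < 2 * d + 1, groupY k s t i l = (-1) ^ l * (t i + l) := fun l hl => by
    rw [groupY, if_pos (by omega)]
  have hY' : ∀ l < 2 * d + 1, groupY k s t i l =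
      (-1) ^ l * (t i + l - if l < 0 then 1 else 0) := by simpa using hY
  have hz := sum_zigzag hX (Δ := 0) (by simp) hY' d
  have hXs : ∀ r, ∑ l ∈ range (2 * d + 1 + r), groupX k s R i l =
      ∑ q ∈ range (r + 1), R (i + q) := by
    intro r
    rw [sum_range_add, (hz.2 le_rfl).1, sum_range_succ', add_zero, add_comm]
    refine congrArg (· + _) (sum_congr rfl fun q _ => ?_)
    rw [groupX, if_neg (by omega)]
    congr 1
    omega
  have hYs : ∑ l ∈ range k, groupY k s t i l = (s - 1) * k := by
    obtain ⟨r, rfl⟩ : ∃ r, s = r + 1 := ⟨s - 1, by omega⟩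
    have h1 : ∑ q ∈ range r, groupY k (r + 1) t i (2 * d + 1 + q) =
        ∑ q ∈ range r, t (i + (q + 1)) + ∑ q ∈ range r, ((2 * d + 1 : ℤ) + q) := by
      rw [← sum_add_distrib]
      refine sum_congr rfl fun q _ => ?_
      rw [groupY, if_neg (by omega)]
      push_cast
      congr 2
      omega
    have h2 : 2 * ∑ q ∈ range r, ((2 * d + 1 : ℤ) + q) = 2 * (2 * d + 1) * r + r * (r - 1) := by
      clear * -
      induction r with
      | zero => simp
      | succ r ih => rw [sum_range_succ, mul_add, ih]; push_cast; ring
    have h3 := sum_range_add_of_periodic ht i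
    rw [sum_range_succ', add_zero] at h3
    rw [show range k = range (2 * d + 1 + r) by congr 1; omega, sum_range_add, (hz.2 le_rfl).2, h1]
    rw [if_neg (by omega)]
    have hd' : (k : ℤ) = r + 1 + 2 * d := by exact_mod_cast hd
    rw [hd'] at hts ⊢
    push_cast at hts ⊢
    linarith
  refine isBaseWalk_of_zigzag hX (Δ := 0) (by simp) hY' (by omega) ?_ ?_ ?_ ?_ ?_
  · simpa using hR.consecutive i 1 one_pos hs1
  · rw [show range k = range (2 * d + 1 + (s - 1)) by congr 1; omega, hXs, show s - 1 + 1 = s by omega, sum_range_add_of_periodic hR.periodic, hR.sum_eq_zero]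
  · rw [hYs]
    exact dvd_mul_left _ _
  · intro j hj hjk
    obtain ⟨r, rfl⟩ := Nat.exists_eq_add_of_lt hj
    rw [show 2 * d + 1 + r + 1 = 2 * d + 1 + (r + 1) by ring, hXs]
    refine ⟨hR.consecutive i _ (by omega) (by omega), ?_⟩
    rw [sum_range_succ', add_zero, add_sub_cancel_right]
    simp only [← add_assoc, add_right_comm i _ 1]
    exact hR.consecutive (i + 1) _ (by omega) (by omega)
  · intro j j' hj hjj' hj'
    left
    obtain ⟨r, rfl⟩ := Nat.exists_eq_add_of_lt hj
    obtain ⟨r', rfl⟩ := Nat.exists_eq_add_of_lt hjj'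
    rw [show 2 * d + 1 + r + 1 + r' + 1 = 2 * d + 1 + (r + 1 + (r' + 1)) by ring,
      show 2 * d + 1 + r + 1 = 2 * d + 1 + (r + 1) by ring, hXs, hXs, add_right_comm _ (r' + 1) 1,
      sum_range_add _ (r + 1 + 1), add_sub_cancel_left]
    simp only [← add_assoc i]
    exact hR.consecutive _ _ (by omega) (by omega)

/-- Position of the step `R c + y * m` in the walks attached to a zero-sum cycle. -/
def groupPos (k : ℕ) (t y : ℤ) : ℕ := ((y - t) % k).toNat

theorem groupPos_lt {k : ℕ} (hk : 0 < k) (t y : ℤ) : groupPos k t y < k := by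
  have h1 := Int.emod_nonneg (y - t) (show (k : ℤ) ≠ 0 by omega)
  have h2 := Int.emod_lt_of_pos (y - t) (show (0 : ℤ) < k by omega)
  rw [groupPos]; omega

theorem intCast_add_mul_eq {v m k : ℕ} (hv : v = m * k) {r y y' : ℤ} (h : (k : ℤ) ∣ y - y') :
    ((r + y * m : ℤ) : ZMod v) = ((r + y' * m : ℤ) : ZMod v) := by
  rw [← sub_eq_zero, ← Int.cast_sub, ZMod.intCast_zmod_eq_zero_iff_dvd, hv]
  obtain ⟨c, hc⟩ := h
  exact ⟨c, by push_cast; linear_combination m * hc⟩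

theorem intCast_add_groupPos {v m k : ℕ} (hk : 0 < k) (hv : v = m * k) (r t y : ℤ) :
    ((r + y * m : ℤ) : ZMod v) = ((r + (t + groupPos k t y) * m : ℤ) : ZMod v) := by
  apply intCast_add_mul_eq hv
  rw [groupPos, Int.toNat_of_nonneg (Int.emod_nonneg _ (by omega)), Int.emod_def]
  exact ⟨(y - t) / k, by ring⟩

theorem periodic_mod {s : ℕ} {f : ℕ → ℤ} (hf : ∀ c, f (c + s) = f c) (c : ℕ) : f (c % s) = f c := by
  have h : ∀ q, f (c % s + s * q) = f (c % s) := by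
    intro q
    induction q with
    | zero => simp
    | succ q ih => rw [mul_add, mul_one, ← add_assoc, hf, ih]
  conv_rhs => rw [← Nat.mod_add_div c s, h]

/-- Every element of `ZMod (m * k)` in a residue class modulo `m` of a zero-sum cycle is, up to
sign, a step of one of the attached walks. -/
theorem group_step {v m k s : ℕ} {R t : ℕ → ℤ} (hv : v = m * k) (hsk : s < k) (hs : 0 < s)
    (hR : ∀ c, R (c + s) = R c) (ht : ∀ c, t (c + s) = t c) {c : ℕ} (y : ℤ) :
    letI l := groupPos k (t c) y
    letI i := (c + s - (l - (k - s))) % s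
    ((R c + y * m : ℤ) : ZMod v) = intStep v m (groupX k s R i) (groupY k s t i) l ∨
    ((R c + y * m : ℤ) : ZMod v) = -intStep v m (groupX k s R i) (groupY k s t i) l := by
  have hl := groupPos_lt (show 0 < k by omega) (t c) y
  rw [intCast_add_groupPos (by omega) hv (R c) (t c) y]
  generalize groupPos k (t c) y = l at *
  simp only [intStep, groupX, groupY, ← Int.cast_neg]
  split_ifs with h
  · rw [Nat.sub_eq_zero_of_le h, Nat.sub_zero, Nat.add_mod_right, periodic_mod hR, periodic_mod ht]
    rcases neg_one_pow_eq_or ℤ l with h | h <;> rw [h]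
    · left; congr 1; ring
    · right; congr 1; ring
  · left
    have key : ∀ f : ℕ → ℤ, (∀ c, f (c + s) = f c) →
        f ((c + s - (l - (k - s))) % s + (l - (k - s))) = f c := by
      intro f hf
      rw [← periodic_mod hf, Nat.mod_add_mod, periodic_mod hf,
        show c + s - (l - (k - s)) + (l - (k - s)) = c + s by omega, hf]
    rw [key R hR, key t ht]

/-- The shift `t` can be recovered modulo `k` from the partition of the residues modulo `k` by the
overflow of their position. -/
theorem dvd_sub_of_groupPos {k s : ℕ} (hs1 : 1 < s) (hsk : s < k) {t t' : ℤ}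
    (h : ∀ y y', groupPos k t y - (k - s) = groupPos k t y' - (k - s) ↔
      groupPos k t' y - (k - s) = groupPos k t' y' - (k - s)) : (k : ℤ) ∣ t - t' := by
  have h1 := h t (t + 1)
  have h2 := h t (t - 1)
  have e0 : groupPos k t t = 0 := by simp [groupPos]
  have e1 : groupPos k t (t + 1) = 1 := by
    rw [groupPos, add_sub_cancel_left, Int.emod_eq_of_lt] <;> omega
  have e2 : groupPos k t (t - 1) = k - 1 := by
    rw [groupPos, show t - 1 - t = (k - 1) + k * (-1) by ring, Int.add_mul_emod_self_left,
      Int.emod_eq_of_lt] <;> omega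
  rw [e0, e1] at h1
  rw [e0, e2] at h2
  apply Int.dvd_of_emod_eq_zero
  have p0 := Int.emod_nonneg (t - t') (show (k : ℤ) ≠ 0 by omega)
  have p1 := Int.emod_lt_of_pos (t - t') (show (0 : ℤ) < k by omega)
  by_contra hne
  have g0 : groupPos k t' t = ((t - t') % k).toNat := rfl
  have g2 : groupPos k t' (t - 1) = ((t - t') % k - 1).toNat := by
    rw [groupPos, show t - 1 - t' = ((t - t') % k - 1) + k * ((t - t') / k) by
      have := Int.emod_add_mul_ediv (t - t') k; linarith, Int.add_mul_emod_self_left,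
      Int.emod_eq_of_lt] <;> omega
  rcases lt_or_ge ((t - t') % k) (k - 1) with hlt | hge
  · have g1 : groupPos k t' (t + 1) = ((t - t') % k + 1).toNat := by
      rw [groupPos, show t + 1 - t' = ((t - t') % k + 1) + k * ((t - t') / k) by
        have := Int.emod_add_mul_ediv (t - t') k; linarith, Int.add_mul_emod_self_left,
        Int.emod_eq_of_lt] <;> omega
    rw [g0, g1] at h1
    rw [g0, g2] at h2
    omega
  · have g1 : groupPos k t' (t + 1) = 0 := by
      rw [groupPos, show t + 1 - t' = k * ((t - t') / k + 1) by
        have := Int.emod_add_mul_ediv (t - t') k; linarith, Int.mul_emod_right, Int.toNat_zero]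
    rw [g0, g1] at h1
    omega

theorem prod_Icc_three_one_sub_inv {P : ℕ} (hP : 2 ≤ P) :
    ∏ q ∈ Icc 3 P, (1 - (q : ℚ)⁻¹) = 2 / P := by
  induction P, hP using Nat.le_induction with
  | base => simp
  | succ P hP ih =>
    rw [Finset.prod_Icc_succ_top (by omega), ih]
    have : (P : ℚ) ≠ 0 := by positivity
    push_cast
    field_simp
    ring

theorem two_div_le_prod {P : ℕ} (hP : 2 ≤ P) {S : Finset ℕ} (hS : S ⊆ Icc 3 P) :
    (2 : ℚ) / P ≤ ∏ q ∈ S, (1 - (q : ℚ)⁻¹) := by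
  have hq : ∀ q ∈ Icc 3 P, 0 ≤ 1 - (q : ℚ)⁻¹ := by
    intro q hq
    have : (1 : ℚ) ≤ q := by exact_mod_cast (show 1 ≤ q by have := mem_Icc.1 hq; omega)
    linarith [inv_le_one_of_one_le₀ this]
  rw [← prod_Icc_three_one_sub_inv hP, ← prod_sdiff hS]
  refine mul_le_of_le_one_left (prod_nonneg fun q h => hq q (hS h))
    (prod_le_one (fun q h => hq q (sdiff_subset h)) fun q _ => ?_)
  have : (0 : ℚ) ≤ (q : ℚ)⁻¹ := by positivity
  linarith

/-- If `p` is the largest prime factor of the odd number `k' * p`, then the totient of the latter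
is not too small. -/
theorem le_totient_mul_prime {k' p : ℕ} (hp : p.Prime) (hk : Odd (k' * p))
    (hmax : ∀ q ∈ (k' * p).primeFactors, q ≤ p) : k' + p ≤ (k' * p).totient + 2 := by
  have hk' : Odd k' := (Nat.odd_mul.1 hk).1
  have hp2 := hp.two_le
  rcases le_or_gt p k' with hle | hlt
  · have h1 : (2 : ℚ) / p ≤ ∏ q ∈ (k' * p).primeFactors, (1 - (q : ℚ)⁻¹) := by
      refine two_div_le_prod hp2 fun q hq => mem_Icc.2 ⟨?_, hmax q hq⟩
      have h2 := (Nat.prime_of_mem_primeFactors hq).two_le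
      have h3 : q ≠ 2 := by
        rintro rfl
        exact (Nat.not_even_iff_odd.2 hk) (even_iff_two_dvd.2 (Nat.dvd_of_mem_primeFactors hq))
      omega
    have h2 : (2 * k' : ℚ) ≤ ((k' * p).totient : ℚ) := by
      rw [Nat.totient_eq_mul_prod_factors]
      calc (2 * k' : ℚ) = (k' * p : ℕ) * (2 / p) := by
            have : (p : ℚ) ≠ 0 := by positivity
            push_cast
            field_simp
        _ ≤ _ := by gcongr
    have h3 : 2 * k' ≤ (k' * p).totient := by exact_mod_cast h2
    omega
  · have hnd : ¬p ∣ k' := fun h => by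
      have := Nat.le_of_dvd hk'.pos h
      omega
    rw [mul_comm, Nat.totient_mul_of_prime_of_not_dvd hp hnd]
    rcases eq_or_ne k' 1 with rfl | h1
    · simp; omega
    · have h3 : 2 < k' := by
        obtain ⟨a, rfl⟩ := hk'; omega
      have h4 : 2 ≤ k'.totient :=
        Nat.le_of_dvd (Nat.totient_pos.2 (by omega)) (Nat.totient_even h3).two_dvd
      have := Nat.mul_le_mul_left (p - 1) h4
      omega

theorem totient_le_two_mul_card {k : ℕ} (hk : Odd k) (hk1 : k ≠ 1) :
    k.totient ≤ 2 * #{u ∈ Icc 1 ((k - 1) / 2) | k.Coprime u} := by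
  set A := {u ∈ Icc 1 ((k - 1) / 2) | k.Coprime u}
  have hsub : {a ∈ range k | k.Coprime a} ⊆ A ∪ A.image (k - ·) := by
    intro a ha
    simp only [mem_filter, mem_range] at ha
    have h0 : a ≠ 0 := by
      rintro rfl
      simp [hk1] at ha
    obtain ⟨b, rfl⟩ := hk
    simp only [A, mem_union, mem_image, mem_filter, mem_Icc]
    rcases le_or_gt a b with h | h
    · left
      exact ⟨by omega, ha.2⟩
    · right
      refine ⟨2 * b + 1 - a, ⟨by omega, ?_⟩, by omega⟩
      exact (Nat.coprime_self_sub_right ha.1.le).2 ha.2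
  rw [Nat.totient_eq_card_coprime]
  refine (card_le_card hsub).trans ((card_union_le _ _).trans ?_)
  have := card_image_le (s := A) (f := (k - ·))
  omega

/-- A partition of `{1, …, (k - 1) / 2}` into units, the halves `(k' - 1) / 2 + (e + 1) * k'`, and
a remainder `w`. -/
theorem exists_partition_half {k : ℕ} (hk : Odd k) (h3 : 3 ≤ k) :
    ∃ (k' p L : ℕ) (U : Finset ℕ) (w : ℕ → ℕ), p.Prime ∧ 3 ≤ p ∧ k = k' * p ∧ Odd k' ∧
      L = (k' - 1) * ((p - 1) / 2) ∧ #U = (k' - 1) / 2 ∧ (∀ u ∈ U, k.Coprime u) ∧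
      (∀ a b, a < b → b < L → w a < w b) ∧ (∀ a < L, 1 ≤ w a ∧ 2 * w a < k) ∧
      ∀ j, 1 ≤ j → 2 * j < k → j ∈ U ∨ (∃ e < (p - 1) / 2, j = (k' - 1) / 2 + (e + 1) * k') ∨
        ∃ a < L, j = w a := by
  have hne : k.primeFactors.Nonempty := Nat.nonempty_primeFactors.2 (by omega)
  obtain ⟨p, hpk, hmax⟩ := k.primeFactors.exists_max_image id hne
  have hp := Nat.prime_of_mem_primeFactors hpk
  obtain ⟨k', hk'⟩ := Nat.dvd_of_mem_primeFactors hpk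
  rw [mul_comm] at hk'
  have hodd : Odd k' ∧ Odd p := Nat.odd_mul.1 (hk' ▸ hk)
  have hp3 : 3 ≤ p := by
    have := hp.two_le
    obtain ⟨a, ha⟩ := hodd.2
    omega
  have htot : k' + p ≤ k.totient + 2 := by
    subst hk'
    exact le_totient_mul_prime hp hk hmax
  set A := {u ∈ Icc 1 ((k - 1) / 2) | k.Coprime u}
  have hA : k.totient ≤ 2 * #A := totient_le_two_mul_card hk (by omega)
  obtain ⟨b, hb⟩ := id hodd.1
  obtain ⟨T, hT⟩ := id hodd.2
  have hkk : k = 4 * b * T + 2 * b + 2 * T + 1 := by rw [hk', hb, hT]; ring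
  set X := (range T).image fun e => (k' - 1) / 2 + (e + 1) * k'
  have hXc : #X = T := by
    rw [card_image_of_injective, card_range]
    intro e e' h
    simpa [show k' ≠ 0 by omega] using h
  have hXs : X ⊆ Icc 1 ((k - 1) / 2) := by
    intro x hx
    simp only [X, mem_image, mem_range] at hx
    obtain ⟨e, he, rfl⟩ := hx
    rw [mem_Icc]
    have h1 : (e + 1) * k' ≤ T * k' := Nat.mul_le_mul_right _ he
    have h2 : T * k' = 2 * (b * T) + T := by rw [hb]; ring
    have h3 : k = 4 * (b * T) + 2 * b + 2 * T + 1 := by rw [hkk]; ring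
    constructor
    · have : 1 * 1 ≤ (e + 1) * k' := Nat.mul_le_mul (by omega) (by omega)
      omega
    · omega
  obtain ⟨U, hU, hUc⟩ := exists_subset_card_eq (s := A \ X) (n := b) (by
    have := le_card_sdiff X A
    omega)
  have hUs : U ⊆ Icc 1 ((k - 1) / 2) := fun u hu =>
    (mem_filter.1 (mem_sdiff.1 (hU hu)).1).1
  have hUX : Disjoint U X := disjoint_left.2 fun u hu => (mem_sdiff.1 (hU hu)).2
  set W := Icc 1 ((k - 1) / 2) \ (U ∪ X)
  have hWc : #W = 2 * b * T := by
    rw [card_sdiff_of_subset (union_subset hUs hXs), card_union_of_disjoint hUX, hUc, hXc,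
      Nat.card_Icc]
    have h3 : k = 2 * (2 * b * T) + 2 * b + 2 * T + 1 := by rw [hkk]; ring
    omega
  have hTp : (p - 1) / 2 = T := by omega
  have hbk : (k' - 1) / 2 = b := by omega
  refine ⟨k', p, 2 * b * T, U, fun a => if h : a < 2 * b * T then W.orderEmbOfFin hWc ⟨a, h⟩ else 0,
    hp, hp3, hk', hodd.1, ?_, by omega, ?_, ?_, ?_, ?_⟩
  · rw [hTp, hb, Nat.add_sub_cancel]
  · exact fun u hu => (mem_filter.1 (mem_sdiff.1 (hU hu)).1).2
  · intro a a' h h'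
    simp only [h', h.trans h', dif_pos]
    exact (W.orderEmbOfFin hWc).strictMono h
  · intro a ha
    simp only [ha, dif_pos]
    have := W.orderEmbOfFin_mem hWc ⟨a, ha⟩
    have := (mem_Icc.1 (mem_sdiff.1 this).1)
    omega
  · intro j hj hj'
    by_cases h1 : j ∈ U
    · exact .inl h1
    by_cases h2 : j ∈ X
    · right; left
      rw [hTp]
      obtain ⟨e, he, rfl⟩ := mem_image.1 h2
      exact ⟨e, mem_range.1 he, rfl⟩
    · right; right
      have hW : j ∈ W := mem_sdiff.2 ⟨mem_Icc.2 (by omega), by simp [h1, h2]⟩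
      rw [← mem_coe, ← W.range_orderEmbOfFin hWc] at hW
      obtain ⟨a, rfl⟩ := hW
      exact ⟨a, a.2, by simp⟩

section Alternating

variable {w : ℕ → ℕ} {L h : ℕ}

/-- Bounds and monotonicity for the partial sums of an alternating increasing sequence. -/
theorem alternating_sum_bounds (hw : ∀ a b, a < b → b < L → w a < w b)
    (hh : ∀ a < L, 1 ≤ w a ∧ w a ≤ h) (b : ℕ) :
    (2 * b ≤ L → ∑ a ∈ range (2 * b), (-1 : ℤ) ^ a * w a ≤ -b ∧
      (0 < b → -(h : ℤ) < ∑ a ∈ range (2 * b), (-1 : ℤ) ^ a * w a)) ∧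
    (2 * b + 1 ≤ L → 0 < ∑ a ∈ range (2 * b + 1), (-1 : ℤ) ^ a * w a ∧
      ∑ a ∈ range (2 * b + 1), (-1 : ℤ) ^ a * w a ≤ h) := by
  have key : (2 * b ≤ L → ∑ a ∈ range (2 * b), (-1 : ℤ) ^ a * w a ≤ -b ∧
      (0 < b → (1 : ℤ) - w (2 * b - 1) ≤ ∑ a ∈ range (2 * b), (-1 : ℤ) ^ a * w a)) ∧
    (2 * b + 1 ≤ L → 0 < ∑ a ∈ range (2 * b + 1), (-1 : ℤ) ^ a * w a ∧
      ∑ a ∈ range (2 * b + 1), (-1 : ℤ) ^ a * w a ≤ w (2 * b)) := by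
    induction b with
    | zero =>
      refine ⟨by simp, fun hL => ?_⟩
      have := hh 0 (by omega)
      simp
      omega
    | succ b ih =>
      have e1 : ∑ a ∈ range (2 * (b + 1)), (-1 : ℤ) ^ a * w a =
          ∑ a ∈ range (2 * b), (-1 : ℤ) ^ a * w a + (w (2 * b) - w (2 * b + 1)) := by
        rw [show 2 * (b + 1) = 2 * b + 1 + 1 by ring, sum_range_succ, sum_range_succ]
        simp only [pow_succ, pow_mul]
        ring
      have e2 : ∑ a ∈ range (2 * (b + 1) + 1), (-1 : ℤ) ^ a * w a =
          ∑ a ∈ range (2 * b + 1), (-1 : ℤ) ^ a * w a + (w (2 * b + 2) - w (2 * b + 1)) := by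
        rw [show 2 * (b + 1) + 1 = 2 * b + 1 + 1 + 1 by ring, sum_range_succ,
          sum_range_succ _ (2 * b + 1)]
        simp only [pow_succ, pow_mul]
        ring
      rw [e1, e2]
      constructor
      · intro hL
        have h1 := hw (2 * b) (2 * b + 1) (by omega) (by omega)
        obtain ⟨i1, i2⟩ := ih.1 (by omega)
        refine ⟨by push_cast; omega, fun _ => ?_⟩
        rw [show 2 * (b + 1) - 1 = 2 * b + 1 by omega]
        rcases Nat.eq_zero_or_pos b with rfl | hb
        · have := hh 0 (by omega)
          simp
          omega
        · have := i2 hb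
          have := hw (2 * b - 1) (2 * b) (by omega) (by omega)
          omega
      · intro hL
        have h1 := hw (2 * b) (2 * b + 1) (by omega) (by omega)
        have h2 := hw (2 * b + 1) (2 * b + 2) (by omega) (by omega)
        obtain ⟨i1, i2⟩ := ih.2 (by omega)
        rw [show 2 * (b + 1) = 2 * b + 2 by ring]
        omega
  refine ⟨fun hL => ⟨(key.1 hL).1, fun hb => ?_⟩, fun hL => ⟨(key.2 hL).1, ?_⟩⟩
  · have := (key.1 hL).2 hb
    have := hh (2 * b - 1) (by omega)
    omega
  · have := (key.2 hL).2
    have := hh (2 * b) (by omega)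
    omega

/-- The partial sums of an alternating increasing sequence are distinct, and close together. -/
theorem alternating_sum_ne (hw : ∀ a b, a < b → b < L → w a < w b)
    (hh : ∀ a < L, 1 ≤ w a ∧ w a ≤ h) {j j' : ℕ} (hj : j < j') (hL : j' ≤ L) :
    ∑ a ∈ range j, (-1 : ℤ) ^ a * w a ≠ ∑ a ∈ range j', (-1 : ℤ) ^ a * w a ∧
    |∑ a ∈ range j', (-1 : ℤ) ^ a * w a - ∑ a ∈ range j, (-1 : ℤ) ^ a * w a| ≤ 2 * h := by
  have hbd : ∀ i ≤ L, |∑ a ∈ range i, (-1 : ℤ) ^ a * w a| ≤ h := by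
    intro i hi
    obtain ⟨b, rfl | rfl⟩ := Nat.even_or_odd' i
    · have h1 := (alternating_sum_bounds hw hh b).1 hi
      rcases Nat.eq_zero_or_pos b with rfl | hb
      · simp
      · have := h1.2 hb
        rw [abs_le]; omega
    · have h1 := (alternating_sum_bounds hw hh b).2 hi
      rw [abs_le]; omega
  have hstep : ∀ i, i + 2 ≤ L → (-1 : ℤ) ^ i * (∑ a ∈ range i, (-1 : ℤ) ^ a * w a) >
      (-1 : ℤ) ^ i * ∑ a ∈ range (i + 2), (-1 : ℤ) ^ a * w a := by
    intro i hi
    have := hw i (i + 1) (by omega) (by omega)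
    rw [sum_range_succ, sum_range_succ, pow_succ]
    rcases neg_one_pow_eq_or ℤ i with h | h <;> rw [h] <;> linarith
  have hmono : ∀ d i, i + 2 * d + 2 ≤ L → (-1 : ℤ) ^ i * (∑ a ∈ range i, (-1 : ℤ) ^ a * w a) >
      (-1 : ℤ) ^ i * ∑ a ∈ range (i + 2 * d + 2), (-1 : ℤ) ^ a * w a := by
    intro d i
    induction d with
    | zero => exact hstep i
    | succ d ih =>
      intro hd
      refine lt_trans ?_ (ih (by omega))
      have := hstep (i + 2 * d + 2) (by omega)
      rw [show i + 2 * (d + 1) + 2 = i + 2 * d + 2 + 2 by ring]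
      rwa [show (-1 : ℤ) ^ (i + 2 * d + 2) = (-1) ^ i by
        rw [pow_add, pow_add, pow_mul]; simp] at this
  refine ⟨fun heq => ?_, ?_⟩
  · obtain ⟨d, rfl⟩ := Nat.exists_eq_add_of_lt hj
    obtain ⟨e, rfl | rfl⟩ := Nat.even_or_odd' d
    · obtain ⟨b, rfl | rfl⟩ := Nat.even_or_odd' j
      · have h1 := ((alternating_sum_bounds hw hh b).1 (by omega)).1
        have h2 := ((alternating_sum_bounds hw hh (b + e)).2 (by omega)).1
        rw [show 2 * (b + e) + 1 = 2 * b + 2 * e + 1 by ring] at h2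
        omega
      · have h1 := ((alternating_sum_bounds hw hh b).2 (by omega)).1
        have h2 := ((alternating_sum_bounds hw hh (b + e + 1)).1 (by omega)).1
        rw [show 2 * (b + e + 1) = 2 * b + 1 + 2 * e + 1 by ring] at h2
        omega
    · have := hmono e j (by omega)
      rw [show j + (2 * e + 1) + 1 = j + 2 * e + 2 by ring] at heq
      rw [heq] at this
      exact lt_irrefl _ this
  · have h1 := hbd j (by omega)
    have h2 := hbd j' hL
    rw [abs_le] at *
    omega

end Alternating

theorem isBaseWalk_unit {m k u : ℕ} (hu : k.Coprime u) :
    IsBaseWalk m k 1 (fun _ => 0) (fun _ => u) := by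
  refine ⟨one_pos, one_dvd _, by simp, by simp, by simp, ?_⟩
  intro j hj j' hj' _ b hb b' hb' h
  rw [Nat.lt_one_iff] at hj hj'
  subst hj hj'
  rw [Nat.div_one] at hb hb'
  refine ⟨rfl, ?_⟩
  rw [range_zero, sum_empty, sum_range_one, zero_add, zero_add, ← sub_mul] at h
  have h1 := (Nat.isCoprime_iff_coprime.2 hu).dvd_of_dvd_mul_right h
  have := Int.eq_zero_of_abs_lt_dvd h1 (by rw [abs_lt]; omega)
  omega

theorem IsZeroSumCycle.not_dvd {m s : ℕ} {R : ℕ → ℤ} (hR : IsZeroSumCycle m s R) (hs : 1 < s)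
    (c : ℕ) : ¬(m : ℤ) ∣ R c := by
  simpa using hR.consecutive c 1 one_pos hs

theorem IsZeroSumCycle.sum_three {m : ℕ} {R : ℕ → ℤ} (hR : IsZeroSumCycle m 3 R) :
    R 0 + R 1 + R 2 = 0 := by
  simpa [sum_range_succ] using hR.sum_eq_zero

/-- Residues of the walk through the second class of the special triple. -/
def tripleX (k : ℕ) (R : ℕ → ℤ) (l : ℕ) : ℤ :=
  if l < k - 2 then (-1) ^ l * R 1 else if l = k - 2 then R 2 else R 0

/-- Multiples of `m` in the walk through the second class of the special triple. -/
def tripleY (k Δ : ℕ) (l : ℕ) : ℤ :=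
  if l < k - 2 then (-1) ^ l * (l - if l < Δ then 1 else 0) else
    if l = k - 2 then k - 2 else 4 - (k / 2 : ℕ) + (k - 1)

theorem isBaseWalk_triple {m k Δ : ℕ} {R : ℕ → ℤ} (hk : Odd k) (h5 : 5 ≤ k)
    (hR : IsZeroSumCycle m 3 R) (hΔ : Even Δ) (hΔk : Δ + 3 ≤ k) :
    IsBaseWalk m k k (tripleX k R) (tripleY k Δ) := by
  obtain ⟨d, rfl⟩ : ∃ d, k = 2 * d + 1 + 1 + 1 := by
    obtain ⟨b, rfl⟩ := hk
    exact ⟨b - 1, by omega⟩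
  have hsum := hR.sum_three
  have hX : ∀ l < 2 * d + 1, tripleX (2 * d + 1 + 1 + 1) R l = (-1) ^ l * R 1 := fun l hl => by
    rw [tripleX, if_pos (by omega)]
  have hY : ∀ l < 2 * d + 1, tripleY (2 * d + 1 + 1 + 1) Δ l =
      (-1) ^ l * (0 + l - if l < Δ then 1 else 0) := fun l hl => by
    rw [tripleY, if_pos (by omega), zero_add]
  have hX1 : tripleX (2 * d + 1 + 1 + 1) R (2 * d + 1) = R 2 := by
    rw [tripleX, if_neg (by omega), if_pos (by omega)]
  have hX2 : tripleX (2 * d + 1 + 1 + 1) R (2 * d + 1 + 1) = R 0 := by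
    rw [tripleX, if_neg (by omega), if_neg (by omega)]
  have hz := (sum_zigzag hX hΔ hY d).2 le_rfl
  refine isBaseWalk_of_zigzag hX hΔ hY (by omega) (hR.not_dvd (by omega) _) ?_ ?_ ?_ ?_
  · rw [sum_range_succ, sum_range_succ, hz.1, hX1, hX2]
    linarith
  · rw [sum_range_succ, sum_range_succ, hz.2, if_neg (by omega), tripleY, tripleY,
      if_neg (by omega), if_pos (by omega), if_neg (by omega), if_neg (by omega),
      show (2 * d + 1 + 1 + 1) / 2 = d + 1 by omega]
    exact ⟨2, by push_cast; ring⟩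
  · intro j hj hj'
    obtain rfl : j = 2 * d + 1 + 1 := by omega
    rw [sum_range_succ, hz.1, hX1]
    refine ⟨?_, by rw [add_sub_cancel_left]; exact hR.not_dvd (by omega) _⟩
    rw [show R 1 + R 2 = -R 0 by linarith, dvd_neg]
    exact hR.not_dvd (by omega) _
  · intro j j' h1 h2 h3
    omega

/-- Residues of the walk through the third class of the special triple. -/
def tailX (k L : ℕ) (R : ℕ → ℤ) (l : ℕ) : ℤ :=
  if l < k - 2 - L then (-1) ^ l * R 2 else if l = k - 2 - L then R 0 else
    if l < k - 1 then 0 else R 1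

/-- Multiples of `m` in the walk through the third class of the special triple. -/
def tailY (k L Δ o : ℕ) (ς : ℤ) (w : ℕ → ℕ) (l : ℕ) : ℤ :=
  if l < k - 2 - L then (-1) ^ l * (o + l) else
    if l = k - 2 - L then 4 - (k / 2 : ℕ) + (k - 2) else
    if l < k - 1 then ς * ((-1) ^ (l - (k - 1 - L)) * w (l - (k - 1 - L))) else Δ - 1

theorem isBaseWalk_tail {m k L Δ o : ℕ} {ς : ℤ} {w : ℕ → ℕ} {R : ℕ → ℤ} (hk : Odd k)
    (hR : IsZeroSumCycle m 3 R) (hL : Even L) (hLk : L + 3 ≤ k) (hς : ς = 1 ∨ ς = -1)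
    (hw : ∀ a b, a < b → b < L → w a < w b) (hwk : ∀ a < L, 1 ≤ w a ∧ 2 * w a < k)
    (hd : (k : ℤ) ∣ o - (L / 2 : ℕ) + Δ + ς * ∑ a ∈ range L, (-1 : ℤ) ^ a * w a) :
    IsBaseWalk m k k (tailX k L R) (tailY k L Δ o ς w) := by
  obtain ⟨lam, rfl⟩ := hL
  obtain ⟨d, hkd⟩ : ∃ d, k = 2 * d + 1 + 1 + (lam + lam) + 1 := by
    obtain ⟨b, rfl⟩ := hk
    exact ⟨b - lam - 1, by omega⟩
  have hsum := hR.sum_three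
  have hX : ∀ l < 2 * d + 1, tailX k (lam + lam) R l = (-1) ^ l * R 2 := fun l hl => by
    rw [tailX, if_pos (by omega)]
  have hY : ∀ l < 2 * d + 1, tailY k (lam + lam) Δ o ς w l = (-1) ^ l * (o + l) := fun l hl => by
    rw [tailY, if_pos (by omega)]
  have hY' : ∀ l < 2 * d + 1, tailY k (lam + lam) Δ o ς w l =
      (-1) ^ l * (o + l - if l < 0 then 1 else 0) := by simpa using hY
  have hX1 : tailX k (lam + lam) R (2 * d + 1) = R 0 := by
    rw [tailX, if_neg (by omega), if_pos (by omega)]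
  have hz := (sum_zigzag hX (Δ := 0) (by simp) hY' d).2 le_rfl
  have hXa : ∀ a ≤ lam + lam, ∑ l ∈ range (2 * d + 1 + 1 + a), tailX k (lam + lam) R l = -R 1 := by
    intro a ha
    rw [sum_range_add, sum_range_succ, hz.1, hX1, sum_eq_zero]
    · linarith
    · intro l hl
      have := mem_range.1 hl
      rw [tailX, if_neg (by omega), if_neg (by omega), if_pos (by omega)]
  have hYa : ∀ a ≤ lam + lam, ∑ l ∈ range (2 * d + 1 + 1 + a), tailY k (lam + lam) Δ o ς w l =
      o + d + (4 - (k / 2 : ℕ) + (k - 2)) + ς * ∑ b ∈ range a, (-1 : ℤ) ^ b * w b := by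
    intro a ha
    rw [sum_range_add, sum_range_succ, hz.2, if_neg (by omega), sub_zero, mul_sum]
    congr 1
    · rw [tailY, if_neg (by omega), if_pos (by omega)]
    · refine sum_congr rfl fun l hl => ?_
      have := mem_range.1 hl
      rw [tailY, if_neg (by omega), if_neg (by omega), if_pos (by omega),
        show 2 * d + 1 + 1 + l - (k - 1 - (lam + lam)) = l by omega]
  refine isBaseWalk_of_zigzag hX (Δ := 0) (by simp) hY' (by omega) (hR.not_dvd (by omega) _)
    ?_ ?_ ?_ ?_
  · rw [show range k = range (2 * d + 1 + 1 + (lam + lam) + 1) by congr 1, sum_range_succ,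
      hXa _ le_rfl, tailX, if_neg (by omega), if_neg (by omega), if_neg (by omega), neg_add_cancel]
  · rw [show range k = range (2 * d + 1 + 1 + (lam + lam) + 1) by congr 1, sum_range_succ,
      hYa _ le_rfl, tailY, if_neg (by omega), if_neg (by omega), if_neg (by omega)]
    rw [show k / 2 = d + lam + 1 by omega]
    rw [show (lam + lam) / 2 = lam by omega] at hd
    refine (dvd_add hd (dvd_refl (k : ℤ))).trans (dvd_of_eq ?_)
    push_cast
    ring
  · intro j hj hj'
    obtain ⟨a, rfl⟩ := Nat.exists_eq_add_of_lt hj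
    rw [show 2 * d + 1 + a + 1 = 2 * d + 1 + 1 + a by ring, hXa _ (by omega)]
    refine ⟨by rw [dvd_neg]; exact hR.not_dvd (by omega) _, ?_⟩
    rw [show -R 1 - R 2 = R 0 by linarith]
    exact hR.not_dvd (by omega) _
  · intro j j' h1 h2 h3
    right
    obtain ⟨a, rfl⟩ := Nat.exists_eq_add_of_lt h1
    obtain ⟨b, rfl⟩ := Nat.exists_eq_add_of_lt h2
    rw [show 2 * d + 1 + a + 1 + b + 1 = 2 * d + 1 + 1 + (a + b + 1) by ring,
      show 2 * d + 1 + a + 1 = 2 * d + 1 + 1 + a by ring, hXa _ (by omega), hXa _ (by omega),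
      hYa _ (by omega), hYa _ (by omega)]
    refine ⟨rfl, fun hdvd => ?_⟩
    have hne := alternating_sum_ne (h := (k - 1) / 2) (j := a) (j' := a + b + 1) hw
      (fun i hi => by have := hwk i hi; omega) (by omega) (by omega)
    rw [add_sub_add_left_eq_sub, ← mul_sub] at hdvd
    have hdvd' : (k : ℤ) ∣ ∑ i ∈ range (a + b + 1), (-1 : ℤ) ^ i * w i -
        ∑ i ∈ range a, (-1 : ℤ) ^ i * w i := by
      rcases hς with rfl | rfl
      · simpa only [one_mul] using hdvd
      · rw [neg_one_mul, dvd_neg] at hdvd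
        exact hdvd
    have := Int.eq_zero_of_abs_lt_dvd hdvd' (by omega)
    exact hne.1 (by omega)

/-- Some walk of the family has a step which, up to sign, is `r + y * m` modulo `m * k`. -/
def Hits {κ : Type*} (k : ℕ) (ℓ : κ → ℕ) (X Y : κ → ℕ → ℤ) (r y : ℤ) : Prop :=
  ∃ i, ∃ l < ℓ i, X i l = r ∧ (k : ℤ) ∣ y - Y i l ∨ X i l = -r ∧ (k : ℤ) ∣ y + Y i l

theorem hits_of_pow {κ : Type*} {k : ℕ} {ℓ : κ → ℕ} {X Y : κ → ℕ → ℤ} {r y y' : ℤ} {i : κ}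
    {l e : ℕ} (hl : l < ℓ i) (hX : X i l = (-1) ^ e * r) (hY : Y i l = (-1) ^ e * y')
    (hy : (k : ℤ) ∣ y - y') : Hits k ℓ X Y r y := by
  refine ⟨i, l, hl, ?_⟩
  rw [hX, hY]
  rcases neg_one_pow_eq_or ℤ e with h | h <;> rw [h]
  · left; simpa using hy
  · right; simpa [← sub_eq_add_neg] using hy

theorem hits_of_eq {κ : Type*} {k : ℕ} {ℓ : κ → ℕ} {X Y : κ → ℕ → ℤ} {r y y' : ℤ} {i : κ}
    {l : ℕ} (hl : l < ℓ i) (hX : X i l = r) (hY : Y i l = y')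
    (hy : (k : ℤ) ∣ y - y') : Hits k ℓ X Y r y :=
  hits_of_pow (e := 0) hl (by simpa using hX) (by simpa using hY) hy

theorem exists_dvd_sub_add {k : ℕ} (hk : 0 < k) (t y : ℤ) :
    ∃ l : ℕ, l < k ∧ (k : ℤ) ∣ y - (t + l) := by
  refine ⟨groupPos k t y, groupPos_lt hk t y, ?_⟩
  rw [groupPos, Int.toNat_of_nonneg (Int.emod_nonneg _ (by omega)), Int.emod_def]
  exact ⟨(y - t) / k, by ring⟩

/-- Offsets closing the third walk of the special triple. -/
theorem exists_offsets {k L : ℕ} {S : ℤ} (hk : Odd k) (hL : Even L) (hLk : 2 * L + 3 ≤ k)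
    (hS : S ≤ -(L / 2 : ℕ)) (hS' : 2 * (-S) + 3 ≤ k) (hS0 : L = 0 → S = 0) :
    ∃ (o b Δ : ℕ) (ς : ℤ), (ς = 1 ∨ ς = -1) ∧ Even Δ ∧ Δ + 3 ≤ k ∧
      (k : ℤ) ∣ o - (L / 2 : ℕ) + Δ + ς * S ∧
      ∀ l < k - 2, o ≤ l ∧ l - o < k - 2 - L ∨ b ≤ l ∧ l - b < L := by
  obtain ⟨lam, rfl⟩ := hL
  rw [show (lam + lam) / 2 = lam by omega] at *
  obtain ⟨σ, hσ⟩ : ∃ σ : ℕ, S = -σ := ⟨(-S).toNat, by omega⟩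
  subst hσ
  rcases Nat.even_or_odd (lam + σ) with h | h
  · refine ⟨0, k - 2 - (lam + lam), lam + σ, 1, .inl rfl, h, by omega, ?_, by omega⟩
    exact ⟨0, by push_cast; ring⟩
  · have : 3 ≤ lam + σ := by
      obtain ⟨a, ha⟩ := h
      omega
    refine ⟨lam + lam, 0, k - (lam + σ), -1, .inr rfl, Nat.Odd.sub_odd hk h, by omega, ?_, by omega⟩
    rw [Nat.cast_sub (by omega)]
    exact dvd_of_eq (by push_cast; ring)

/-- Residues of a short walk. -/
def blockX (k' : ℕ) (R : ℕ → ℤ) (l : ℕ) : ℤ := if l < k' - 1 then (-1) ^ l * R 2 else 0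

/-- Multiples of `m` in a short walk. -/
def blockY (k' b e : ℕ) (l : ℕ) : ℤ :=
  if l < k' - 1 then (-1) ^ l * ((b + e * (k' - 1) : ℕ) + l) else ((k' - 1) / 2 : ℕ) + (e + 1 : ℕ) * k'

/-- A family of walks whose steps cover the multiples of `m` and the residue classes of a
zero-sum triple. -/
theorem exists_special {m k : ℕ} (hk : Odd k) (h7 : 7 ≤ k) {R : ℕ → ℤ}
    (hR : IsZeroSumCycle m 3 R) :
    ∃ (κ : Type) (_ : Fintype κ) (ℓ : κ → ℕ) (X Y : κ → ℕ → ℤ),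
      (∀ i, IsBaseWalk m k (ℓ i) (X i) (Y i)) ∧ 2 * ∑ i, ℓ i + 1 = 7 * k ∧
      (∀ c < 3, ∀ y : ℤ, Hits k ℓ X Y (R c) y) ∧ ∀ y : ℤ, ¬(k : ℤ) ∣ y → Hits k ℓ X Y 0 y := by
  obtain ⟨k', p, L, U, w, hp, hp3, hkp, hk', hL, hUc, hU, hw, hwk, hcov⟩ :=
    exists_partition_half hk (by omega)
  obtain ⟨b₀, hb₀⟩ := hk'
  obtain ⟨T, hT⟩ : Odd p := (Nat.odd_mul.1 (hkp ▸ hk)).2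
  have hT' : (p - 1) / 2 = T := by omega
  rw [hT'] at hL hcov
  have hkL : k = 2 * L + 2 * b₀ + 2 * T + 1 := by
    rw [hL, hkp, hT, hb₀, Nat.add_sub_cancel]; ring
  have hLe : Even L := by
    rw [hL, hb₀, Nat.add_sub_cancel]
    exact ⟨b₀ * T, by ring⟩
  have hkodd : k = 2 * (k / 2) + 1 := by obtain ⟨a, rfl⟩ := hk; omega
  set S := ∑ a ∈ range L, (-1 : ℤ) ^ a * w a with hSdef
  have hS : S ≤ -(L / 2 : ℕ) ∧ 2 * (-S) + 3 ≤ k := by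
    obtain ⟨lam, hlam⟩ := hLe
    have := (alternating_sum_bounds (h := (k - 1) / 2) hw
      (fun a ha => by have := hwk a ha; omega) lam).1 (by omega)
    rw [show 2 * lam = L by omega, ← hSdef] at this
    refine ⟨by omega, ?_⟩
    rcases Nat.eq_zero_or_pos lam with h0 | h0
    · have : L = 0 := by omega
      rw [this] at hSdef
      simp at hSdef
      omega
    · have := this.2 h0
      omega
  obtain ⟨o, b, Δ, ς, hς, hΔ, hΔk, hclose, hob⟩ := exists_offsets hk hLe (by omega) hS.1 hS.2
    fun h => by simp [hSdef, h]
  set t : ℕ → ℤ := fun c => if c % 3 = 0 then 4 - (k / 2 : ℕ) else 0 with ht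
  let ℓ : Fin 3 ⊕ Fin T ⊕ U → ℕ := Sum.elim (fun _ => k) (Sum.elim (fun _ => k') fun _ => 1)
  let X : Fin 3 ⊕ Fin T ⊕ U → ℕ → ℤ :=
    Sum.elim ![groupX k 3 R 0, tripleX k R, tailX k L R] (Sum.elim (fun _ => blockX k' R) fun _ _ => 0)
  let Y : Fin 3 ⊕ Fin T ⊕ U → ℕ → ℤ :=
    Sum.elim ![groupY k 3 t 0, tripleY k Δ, tailY k L Δ o ς w]
      (Sum.elim (fun e => blockY k' b e) fun u _ => (u : ℕ))
  have hits0 {l : ℕ} {r y y' : ℤ} (e : ℕ) (hl : l < k) (hX : groupX k 3 R 0 l = (-1) ^ e * r)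
      (hY : groupY k 3 t 0 l = (-1) ^ e * y') (hy : (k : ℤ) ∣ y - y') : Hits k ℓ X Y r y :=
    hits_of_pow (i := Sum.inl 0) hl hX hY hy
  have hits1 {l : ℕ} {r y y' : ℤ} (e : ℕ) (hl : l < k) (hX : tripleX k R l = (-1) ^ e * r)
      (hY : tripleY k Δ l = (-1) ^ e * y') (hy : (k : ℤ) ∣ y - y') : Hits k ℓ X Y r y :=
    hits_of_pow (i := Sum.inl 1) hl hX hY hy
  have hits2 {l : ℕ} {r y y' : ℤ} (e : ℕ) (hl : l < k) (hX : tailX k L R l = (-1) ^ e * r)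
      (hY : tailY k L Δ o ς w l = (-1) ^ e * y') (hy : (k : ℤ) ∣ y - y') : Hits k ℓ X Y r y :=
    hits_of_pow (i := Sum.inl 2) hl hX hY hy
  refine ⟨_, inferInstance, ℓ, X, Y, ?_, ?_, ?_, ?_⟩
  · rintro (i | e | u)
    · fin_cases i
      · refine isBaseWalk_group hk (by decide) (by omega) (by omega) hR (fun c => ?_) ?_ 0
        · simp only [ht, Nat.add_mod_right]
        · simp [ht, sum_range_succ]
          omega
      · exact isBaseWalk_triple hk (by omega) hR hΔ hΔk
      · exact isBaseWalk_tail hk hR hLe (by omega) hς hw hwk hclose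
    · change IsBaseWalk m k k' (blockX k' R) (blockY k' b e)
      refine isBaseWalk_of_zigzag_short (x := R 2) (t := (b + e.1 * (k' - 1) : ℕ)) (z := e.1 + 1)
        hp hkp ⟨b₀, hb₀⟩ (fun l hl => if_pos hl) (fun l hl => if_pos hl) (if_neg (by omega)) ?_
        (by omega) (by have := e.2; omega) (hR.not_dvd (by omega) _)
      exact if_neg (by omega)
    · exact isBaseWalk_unit (hU u u.2)
  · simp only [ℓ, Fintype.sum_sum_type, Sum.elim_inl, Sum.elim_inr, sum_const, card_univ,
      Fintype.card_fin, Fintype.card_coe, smul_eq_mul, mul_one, hUc]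
    have : T * k' = L + T := by rw [hL, hb₀, Nat.add_sub_cancel]; ring
    omega
  · intro c hc y
    interval_cases c
    · obtain ⟨l, hl, hy⟩ := exists_dvd_sub_add (show 0 < k by omega) (4 - (k / 2 : ℕ)) y
      rcases lt_trichotomy l (k - 2) with h | h | h
      · exact hits0 l hl (if_pos (by omega)) (if_pos (by omega)) hy
      · refine hits2 (l := k - 2 - L) 0 (by omega) ?_ ?_ hy
        · rw [tailX, if_neg (by omega), if_pos rfl, pow_zero, one_mul]
        · rw [tailY, if_neg (by omega), if_pos rfl, pow_zero, one_mul, h]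
          omega
      · refine hits1 (l := k - 1) 0 (by omega) ?_ ?_ hy
        · rw [tripleX, if_neg (by omega), if_neg (by omega), pow_zero, one_mul]
        · rw [tripleY, if_neg (by omega), if_neg (by omega), pow_zero, one_mul]
          omega
    · obtain ⟨l, hl, hy⟩ := exists_dvd_sub_add (show 0 < k by omega) 0 y
      rw [zero_add] at hy
      rcases lt_trichotomy l (k - 2) with h | h | h
      · rcases lt_trichotomy (l + 1) Δ with h1 | h1 | h1
        · refine hits1 (l := l + 1) (l + 1) (by omega) (if_pos (by omega)) ?_ hy
          rw [tripleY, if_pos (by omega), if_pos h1, Nat.cast_succ, add_sub_cancel_right]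
        · refine hits2 (l := k - 1) 0 (by omega) ?_ ?_ hy
          · rw [tailX, if_neg (by omega), if_neg (by omega), if_neg (by omega), pow_zero, one_mul]
          · rw [tailY, if_neg (by omega), if_neg (by omega), if_neg (by omega), pow_zero, one_mul]
            omega
        · refine hits1 (l := l) l (by omega) (if_pos (by omega)) ?_ hy
          rw [tripleY, if_pos (by omega), if_neg (by omega), sub_zero]
      · refine hits0 (l := k - 2) 0 (by omega) ?_ ?_ hy
        · rw [groupX, if_neg (by omega), pow_zero, one_mul, show 0 + (k - 2 - (k - 3)) = 1 by omega]
        · rw [groupY, if_neg (by omega), pow_zero, one_mul, show 0 + (k - 2 - (k - 3)) = 1 by omega]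
          simp [ht, h]
      · have hy' : (k : ℤ) ∣ y - (-1) := by
          refine (dvd_add hy (dvd_refl (k : ℤ))).trans (dvd_of_eq ?_)
          omega
        rcases Nat.eq_zero_or_pos Δ with h1 | h1
        · refine hits2 (l := k - 1) 0 (by omega) ?_ ?_ hy'
          · rw [tailX, if_neg (by omega), if_neg (by omega), if_neg (by omega), pow_zero, one_mul]
          · rw [tailY, if_neg (by omega), if_neg (by omega), if_neg (by omega), pow_zero, one_mul]
            omega
        · refine hits1 (l := 0) 0 (by omega) (if_pos (by omega)) ?_ hy'
          rw [tripleY, if_pos (by omega), if_pos h1]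
          simp
    · obtain ⟨l, hl, hy⟩ := exists_dvd_sub_add (show 0 < k by omega) 0 y
      rw [zero_add] at hy
      rcases lt_trichotomy l (k - 2) with h | h | h
      · rcases hob l h with ⟨h1, h2⟩ | ⟨h1, h2⟩
        · refine hits2 (l := l - o) (l - o) (by omega) (if_pos h2) ?_ hy
          rw [tailY, if_pos h2]
          congr 1
          omega
        · rw [hL] at h2
          have hpos : 0 < k' - 1 := Nat.pos_of_ne_zero fun h => by simp [h] at h2
          have he : (l - b) / (k' - 1) < T := Nat.div_lt_of_lt_mul h2
          have hmod := Nat.mod_lt (l - b) hpos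
          refine hits_of_pow (i := Sum.inr (Sum.inl ⟨(l - b) / (k' - 1), he⟩))
            (l := (l - b) % (k' - 1)) (e := (l - b) % (k' - 1)) ?_ (if_pos hmod) (if_pos hmod) ?_
          · exact hmod.trans_le (Nat.sub_le _ _)
          · refine hy.trans (dvd_of_eq ?_)
            have := Nat.div_add_mod' (l - b) (k' - 1)
            push_cast
            have h3 : (((l - b) / (k' - 1) * (k' - 1) : ℕ) : ℤ) + ((l - b) % (k' - 1) : ℕ) = l - b := by
              omega
            push_cast at h3
            linarith
      · refine hits1 (l := k - 2) 0 (by omega) ?_ ?_ hy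
        · rw [tripleX, if_neg (by omega), if_pos rfl, pow_zero, one_mul]
        · rw [tripleY, if_neg (by omega), if_pos rfl, pow_zero, one_mul]
          omega
      · refine hits0 (l := k - 1) 0 (by omega) ?_ ?_ hy
        · rw [groupX, if_neg (by omega), pow_zero, one_mul, show 0 + (k - 1 - (k - 3)) = 2 by omega]
        · rw [groupY, if_neg (by omega), pow_zero, one_mul, show 0 + (k - 1 - (k - 3)) = 2 by omega]
          simp only [ht]
          norm_num
          omega
  · intro y hy
    have key : ∀ (j : ℕ), 1 ≤ j → 2 * j < k → ∀ y : ℤ, (k : ℤ) ∣ y - j → Hits k ℓ X Y 0 y := by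
      intro j hj1 hj2 y hy
      rcases hcov j hj1 hj2 with h | ⟨e, he, h⟩ | ⟨a, ha, h⟩
      · exact hits_of_eq (i := Sum.inr (Sum.inr ⟨j, h⟩)) (l := 0) one_pos rfl rfl hy
      · refine hits_of_eq (i := Sum.inr (Sum.inl ⟨e, he⟩)) (l := k' - 1)
          (show k' - 1 < k' by omega) (if_neg (by omega)) (if_neg (by omega)) ?_
        rw [h] at hy
        exact_mod_cast hy
      · obtain ⟨e, he⟩ : ∃ e : ℕ, ς * (-1) ^ a = (-1) ^ e := by
          rcases hς with rfl | rfl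
          · exact ⟨a, one_mul _⟩
          · exact ⟨a + 1, by rw [pow_succ]; ring⟩
        refine hits2 (l := k - 1 - L + a) e (by omega) ?_ ?_ (h ▸ hy)
        · rw [tailX, if_neg (by omega), if_neg (by omega), if_pos (by omega), mul_zero]
        · rw [tailY, if_neg (by omega), if_neg (by omega), if_pos (by omega), Nat.add_sub_cancel_left,
            ← he, mul_assoc]
    obtain ⟨l, hl, hyl⟩ := exists_dvd_sub_add (show 0 < k by omega) 0 y
    rw [zero_add] at hyl
    have hl0 : l ≠ 0 := by
      rintro rfl
      simp at hyl
      exact hy hyl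
    rcases le_or_gt l (k / 2) with h | h
    · exact key l (by omega) (by omega) y hyl
    · obtain ⟨i, l', hl', h1⟩ := key (k - l) (by omega) (by omega) (-y) (by
        rw [Nat.cast_sub hl.le]
        refine (dvd_sub (dvd_neg.2 hyl) (dvd_refl (k : ℤ))).trans (dvd_of_eq (by ring)))
      refine ⟨i, l', hl', ?_⟩
      rw [neg_zero] at *
      rcases h1 with h1 | h1
      · right
        exact ⟨h1.1, (dvd_neg.2 h1.2).trans (dvd_of_eq (by ring))⟩
      · left
        exact ⟨h1.1, (dvd_neg.2 h1.2).trans (dvd_of_eq (by ring))⟩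

/-- Residues `R g c`, for `c < s g`, forming zero-sum cycles of lengths `3` and `5` and covering
the nonzero classes modulo `2 * n + 1` up to sign; `none` is the index of a cycle of length `3`. -/
structure IsZeroSumPartition {G : Type} [Fintype G] (n : ℕ) (s : Option G → ℕ)
    (R : Option G → ℕ → ℤ) : Prop where
  length_none : s none = 3
  length_eq : ∀ g, s g = 3 ∨ s g = 5
  sum_length : ∑ g, s g = n
  isZeroSumCycle : ∀ g, IsZeroSumCycle (2 * n + 1) (s g) (R g)
  cover : ∀ x : ℤ, ¬((2 * n + 1 : ℕ) : ℤ) ∣ x → ∃ g, ∃ c < s g,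
    ((2 * n + 1 : ℕ) : ℤ) ∣ x - R g c ∨ ((2 * n + 1 : ℕ) : ℤ) ∣ x + R g c

theorem eq_of_dvd_sub_or_add {n r r' : ℕ} {x x' : ℤ} (hr : 1 ≤ r) (hrn : r ≤ n) (hr' : 1 ≤ r')
    (hrn' : r' ≤ n) (h : ((2 * n + 1 : ℕ) : ℤ) ∣ r - x ∨ ((2 * n + 1 : ℕ) : ℤ) ∣ r + x)
    (h' : ((2 * n + 1 : ℕ) : ℤ) ∣ r' - x' ∨ ((2 * n + 1 : ℕ) : ℤ) ∣ r' + x')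
    (hx : ((2 * n + 1 : ℕ) : ℤ) ∣ x - x' ∨ ((2 * n + 1 : ℕ) : ℤ) ∣ x + x') : r = r' := by
  have key : ((2 * n + 1 : ℕ) : ℤ) ∣ r - r' ∨ ((2 * n + 1 : ℕ) : ℤ) ∣ r + r' := by
    rcases h with ⟨a, h⟩ | ⟨a, h⟩ <;> rcases h' with ⟨b, h'⟩ | ⟨b, h'⟩ <;>
      rcases hx with ⟨c, hx⟩ | ⟨c, hx⟩
    · exact .inl ⟨a - b + c, by linear_combination h - h' + hx⟩
    · exact .inr ⟨a + b + c, by linear_combination h + h' + hx⟩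
    · exact .inr ⟨a + b + c, by linear_combination h + h' + hx⟩
    · exact .inl ⟨a - b + c, by linear_combination h - h' + hx⟩
    · exact .inr ⟨a + b - c, by linear_combination h + h' - hx⟩
    · exact .inl ⟨a - b - c, by linear_combination h - h' - hx⟩
    · exact .inl ⟨a - b - c, by linear_combination h - h' - hx⟩
    · exact .inr ⟨a + b - c, by linear_combination h + h' - hx⟩
  rcases key with h | h
  · have := Int.eq_zero_of_abs_lt_dvd h (by rw [abs_lt]; constructor <;> push_cast <;> omega)
    omega
  · have := Int.le_of_dvd (by omega) h
    omega

/-- Zero-sum families which cover every class up to sign and have the right total length are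
zero-sum cycles. -/
theorem isZeroSumPartition_of_cover {G : Type} [Fintype G] {n : ℕ} {s : Option G → ℕ}
    {R : Option G → ℕ → ℤ} (hs0 : s none = 3) (hs : ∀ g, s g = 3 ∨ s g = 5)
    (hsum : ∑ g, s g = n) (hper : ∀ g c, R g (c + s g) = R g c)
    (hzero : ∀ g, ∑ c ∈ range (s g), R g c = 0)
    (hcov : ∀ r : ℕ, 1 ≤ r → r ≤ n → ∃ g, ∃ c < s g,
      ((2 * n + 1 : ℕ) : ℤ) ∣ r - R g c ∨ ((2 * n + 1 : ℕ) : ℤ) ∣ r + R g c) :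
    IsZeroSumPartition n s R := by
  have hf : ∀ r : Fin n, ∃ p : Σ g, Fin (s g), ((2 * n + 1 : ℕ) : ℤ) ∣ (r.1 + 1 : ℕ) - R p.1 p.2 ∨
      ((2 * n + 1 : ℕ) : ℤ) ∣ (r.1 + 1 : ℕ) + R p.1 p.2 := fun r => by
    obtain ⟨g, c, hc, h⟩ := hcov (r.1 + 1) (by omega) r.2
    exact ⟨⟨g, c, hc⟩, h⟩
  choose f hf using hf
  have hinj : Function.Injective f := fun r r' h => by
    have h' := hf r'
    rw [← h] at h'
    have := eq_of_dvd_sub_or_add (by omega) r.2 (by omega) r'.2 (hf r) h' (.inl (by simp))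
    omega
  have hbij : Function.Bijective f :=
    (Fintype.bijective_iff_injective_and_card f).2 ⟨hinj, by simp [hsum]⟩
  have hne0 : ∀ g, ∀ c, ¬((2 * n + 1 : ℕ) : ℤ) ∣ R g c := by
    intro g c h
    have hsg : 0 < s g := by have := hs g; omega
    rw [← periodic_mod (hper g)] at h
    obtain ⟨r, hr⟩ := hbij.2 ⟨g, c % s g, Nat.mod_lt _ hsg⟩
    have h1 := hf r
    rw [hr] at h1
    have h2 : ((2 * n + 1 : ℕ) : ℤ) ∣ (r.1 + 1 : ℕ) := by
      rcases h1 with h1 | h1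
      · exact (dvd_sub_left h).1 h1
      · exact (dvd_add_left h).1 h1
    have := Nat.le_of_dvd (by omega) (Int.natCast_dvd_natCast.1 h2)
    omega
  have hne : ∀ g, ∀ c, ¬((2 * n + 1 : ℕ) : ℤ) ∣ R g c + R g (c + 1) := by
    intro g c h
    have hsg : 1 < s g := by have := hs g; omega
    rw [← periodic_mod (hper g), ← periodic_mod (hper g) (c + 1)] at h
    obtain ⟨r, hr⟩ := hbij.2 ⟨g, c % s g, Nat.mod_lt _ (by omega)⟩
    obtain ⟨r', hr'⟩ := hbij.2 ⟨g, (c + 1) % s g, Nat.mod_lt _ (by omega)⟩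
    have h1 := hf r
    have h2 := hf r'
    rw [hr] at h1
    rw [hr'] at h2
    have h3 := eq_of_dvd_sub_or_add (by omega) r.2 (by omega) r'.2 h1 h2 (.inr h)
    have h4 : r = r' := by omega
    rw [h4, hr'] at hr
    have h5 : (c + 1) % s g = c % s g := by simpa using hr
    have h6 := (Nat.modEq_iff_dvd' (Nat.le_succ c)).1 h5.symm
    rw [Nat.succ_eq_add_one, Nat.add_sub_cancel_left] at h6
    have := Nat.le_of_dvd one_pos h6
    omega
  refine ⟨hs0, hs, hsum, fun g => ⟨hper g, hzero g, fun i r hr hrs => ?_⟩, fun x hx => ?_⟩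
  · have htot := (sum_range_add_of_periodic (hper g) i).trans (hzero g)
    have hsplit : ∑ q ∈ range r, R g (i + q) + ∑ q ∈ range (s g - r), R g (i + r + q) = 0 := by
      rw [← htot, ← Nat.add_sub_cancel' hrs.le, sum_range_add, Nat.add_sub_cancel_left]
      simp only [add_assoc]
    intro h
    have h' : ((2 * n + 1 : ℕ) : ℤ) ∣ ∑ q ∈ range (s g - r), R g (i + r + q) :=
      (dvd_add_right h).1 (hsplit ▸ dvd_zero _)
    by_cases h2 : r ≤ 2
    · interval_cases r
      · simp only [sum_range_one] at h
        exact hne0 g _ h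
      · simp only [sum_range_succ, sum_range_zero, zero_add] at h
        exact hne g _ h
    · obtain h3 | h3 : s g - r = 1 ∨ s g - r = 2 := by have := hs g; omega
      · rw [h3, sum_range_one] at h'
        exact hne0 g _ h'
      · rw [h3] at h'
        simp only [sum_range_succ, sum_range_zero, zero_add] at h'
        exact hne g _ h'
  · set M : ℤ := ((2 * n + 1 : ℕ) : ℤ) with hM
    have hM0 : 0 < M := by positivity
    have h1 := Int.emod_nonneg x hM0.ne'
    have h2 := Int.emod_lt_of_pos x hM0
    have h3 : x % M ≠ 0 := fun h => hx (Int.dvd_of_emod_eq_zero h)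
    have h4 : M ∣ x - x % M := Int.dvd_self_sub_emod
    rcases le_or_gt (x % M) n with h | h
    · obtain ⟨g, c, hc, h5⟩ := hcov (x % M).toNat (by omega) (by omega)
      rw [Int.toNat_of_nonneg h1] at h5
      refine ⟨g, c, hc, h5.imp (fun h5 => ?_) fun h5 => ?_⟩
      · exact (dvd_add h4 h5).trans (dvd_of_eq (by ring))
      · exact (dvd_add h4 h5).trans (dvd_of_eq (by ring))
    · obtain ⟨g, c, hc, h5⟩ := hcov (M - x % M).toNat (by omega) (by omega)
      rw [Int.toNat_of_nonneg (by omega)] at h5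
      refine ⟨g, c, hc, h5.symm.imp (fun h5 => ?_) fun h5 => ?_⟩
      · exact (dvd_sub (dvd_add h4 (dvd_refl M)) h5).trans (dvd_of_eq (by ring))
      · exact (dvd_sub (dvd_add h4 (dvd_refl M)) h5).trans (dvd_of_eq (by ring))

theorem exists_isZeroSumPartition_of_list {n : ℕ} (a : List ℤ) (gs : List (List ℤ))
    (ha : a.length = 3) (hlen : ∀ L ∈ gs, L.length = 3 ∨ L.length = 5)
    (hsum : 3 + (gs.map List.length).sum = n) (hzero : ∀ L ∈ a :: gs, L.sum = 0)
    (hcov : ∀ r : ℕ, 1 ≤ r → r ≤ n → ∃ L ∈ a :: gs, ∃ x ∈ L,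
      ((2 * n + 1 : ℕ) : ℤ) ∣ r - x ∨ ((2 * n + 1 : ℕ) : ℤ) ∣ r + x) :
    ∃ (G : Type) (_ : Fintype G) (s : Option G → ℕ) (R : Option G → ℕ → ℤ),
      IsZeroSumPartition n s R := by
  let f : Option (Fin gs.length) → List ℤ := fun o => o.elim a gs.get
  have hf : ∀ o, f o ∈ a :: gs := by
    rintro (_ | i)
    · exact List.mem_cons_self
    · exact List.mem_cons_of_mem _ (gs.get_mem i)
  have hf' : ∀ L ∈ a :: gs, ∃ o, f o = L := by
    intro L hL
    rcases List.mem_cons.1 hL with rfl | hL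
    · exact ⟨none, rfl⟩
    · obtain ⟨i, hi⟩ := List.mem_iff_get.1 hL
      exact ⟨some i, hi⟩
  refine ⟨Fin gs.length, inferInstance, fun o => (f o).length,
    fun o c => (f o).getD (c % (f o).length) 0, isZeroSumPartition_of_cover ha ?_ ?_ ?_ ?_ ?_⟩
  · rintro (_ | i)
    · exact .inl ha
    · exact hlen _ (gs.get_mem i)
  · rw [Fintype.sum_option, ← hsum, ← ha]
    congr 1
    simp [f, ← List.sum_ofFn, List.ofFn_getElem_eq_map]
  · intro o c
    simp only [Nat.add_mod_right]
  · intro o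
    refine Eq.trans ?_ (hzero _ (hf o))
    generalize f o = L
    rw [← Fin.sum_univ_eq_sum_range (fun c => L.getD (c % L.length) 0), ← Fin.sum_univ_getElem]
    refine sum_congr rfl fun c _ => ?_
    rw [Nat.mod_eq_of_lt c.2, List.getD_eq_getElem _ _ c.2]
  · intro r hr hrn
    obtain ⟨L, hL, x, hx, h⟩ := hcov r hr hrn
    obtain ⟨o, rfl⟩ := hf' L hL
    obtain ⟨c, hc, rfl⟩ := List.mem_iff_getElem.1 hx
    refine ⟨o, c, hc, ?_⟩
    rw [Nat.mod_eq_of_lt hc, List.getD_eq_getElem _ _ hc]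
    exact h

/-- Zero-sum triples covering, up to sign, an odd number and two numbers around `q`. -/
def smallTriple (q j : ℕ) : List ℤ := [2 * j + 1, q - j, -(q + 1 + j)]

/-- Zero-sum quintuples covering, up to sign, an even number, two numbers around `p` and two
consecutive numbers. -/
def smallQuintuple (p x j : ℕ) : List ℤ := [2 * j + 2, p - j, -(p + 1 + j), x + 2 * j, -(x + 2 * j + 1)]

theorem exists_isZeroSumPartition_of_layout {n : ℕ} (O E q p x i : ℕ) (ex : List (List ℤ)) (hO : i < O)
    (hex : ∀ L ∈ ex, L.length = 3 ∨ L.length = 5) (hzero : ∀ L ∈ ex, L.sum = 0)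
    (hsum : 3 * (O - i) + 5 * E + (ex.map List.length).sum = n)
    (hcov : ∀ r : ℕ, 1 ≤ r → r ≤ n →
      (r % 2 = 1 ∧ 2 * i + 1 ≤ r ∧ r < 2 * O) ∨ (r % 2 = 0 ∧ r ≤ 2 * E) ∨
      (q < r + O ∧ r + i ≤ q) ∨ (q + i < r ∧ r ≤ q + O) ∨ (p < r + E ∧ r ≤ p + E) ∨
      (x ≤ r ∧ r < x + 2 * E) ∨
      ∃ L ∈ ex, ∃ y ∈ L, (r : ℤ) = y ∨ (r : ℤ) = -y ∨ (r : ℤ) = y + (2 * n + 1)) :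
    ∃ (G : Type) (_ : Fintype G) (s : Option G → ℕ) (R : Option G → ℕ → ℤ),
      IsZeroSumPartition n s R := by
  let gs := (List.range (O - i - 1)).map (fun j => smallTriple q (i + 1 + j)) ++
    (List.range E).map (smallQuintuple p x) ++ ex
  have hT : ∀ j, i ≤ j → j < O → smallTriple q j ∈ smallTriple q i :: gs := by
    intro j hij hj
    rcases hij.eq_or_lt with rfl | hij
    · exact List.mem_cons_self
    · refine List.mem_cons_of_mem _ (List.mem_append_left _ (List.mem_append_left _
        (List.mem_map.2 ⟨j - (i + 1), List.mem_range.2 (by omega), ?_⟩)))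
      rw [Nat.add_sub_cancel' hij]
  have hF : ∀ j < E, smallQuintuple p x j ∈ smallTriple q i :: gs := fun j hj =>
    List.mem_cons_of_mem _ (List.mem_append_left _ (List.mem_append_right _
        (List.mem_map.2 ⟨j, List.mem_range.2 hj, rfl⟩)))
  have hmem : ∀ L ∈ gs, (∃ j, L = smallTriple q j) ∨ (∃ j, L = smallQuintuple p x j) ∨ L ∈ ex := by
    intro L hL
    rcases List.mem_append.1 hL with hL | hL
    · rcases List.mem_append.1 hL with hL | hL
      · obtain ⟨j, -, rfl⟩ := List.mem_map.1 hL
        exact .inl ⟨_, rfl⟩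
      · obtain ⟨j, -, rfl⟩ := List.mem_map.1 hL
        exact .inr (.inl ⟨_, rfl⟩)
    · exact .inr (.inr hL)
  have hT0 : ∀ j, (smallTriple q j).sum = 0 := fun j => by simp [smallTriple]; ring
  have mkT : ∀ (j r : ℕ) (y : ℤ), i ≤ j → j < O → y ∈ smallTriple q j → (r : ℤ) = y ∨ (r : ℤ) = -y →
      ∃ L ∈ smallTriple q i :: gs, ∃ x ∈ L,
      ((2 * n + 1 : ℕ) : ℤ) ∣ r - x ∨ ((2 * n + 1 : ℕ) : ℤ) ∣ r + x := by
    intro j r y h1 h2 h3 h4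
    refine ⟨_, hT j h1 h2, y, h3, h4.imp (fun h => ?_) fun h => ?_⟩ <;> simp [h]
  have mkF : ∀ (j r : ℕ) (y : ℤ), j < E → y ∈ smallQuintuple p x j → (r : ℤ) = y ∨ (r : ℤ) = -y →
      ∃ L ∈ smallTriple q i :: gs, ∃ x ∈ L,
      ((2 * n + 1 : ℕ) : ℤ) ∣ r - x ∨ ((2 * n + 1 : ℕ) : ℤ) ∣ r + x := by
    intro j r y h1 h3 h4
    refine ⟨_, hF j h1, y, h3, h4.imp (fun h => ?_) fun h => ?_⟩ <;> simp [h]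
  refine exists_isZeroSumPartition_of_list (smallTriple q i) gs rfl ?_ ?_ ?_ ?_
  · intro L hL
    rcases hmem L hL with ⟨j, rfl⟩ | ⟨j, rfl⟩ | h
    · exact .inl rfl
    · exact .inr rfl
    · exact hex L h
  · simp only [gs, List.map_append, List.map_map, List.sum_append]
    have e1 : (List.length ∘ fun j => smallTriple q (i + 1 + j)) = fun _ => 3 := rfl
    have e2 : (List.length ∘ smallQuintuple p x) = fun _ => 5 := rfl
    rw [e1, e2]
    simp only [List.map_const', List.length_range, List.sum_replicate, smul_eq_mul]
    omega
  · intro L hL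
    rcases List.mem_cons.1 hL with rfl | hL
    · exact hT0 i
    rcases hmem L hL with ⟨j, rfl⟩ | ⟨j, rfl⟩ | h
    · exact hT0 j
    · simp [smallQuintuple]; ring
    · exact hzero L h
  · intro r hr hrn
    rcases hcov r hr hrn with h | h | h | h | h | h | h
    · exact mkT (r / 2) r _ (by omega) (by omega) (List.mem_cons_self) (by omega)
    · exact mkF (r / 2 - 1) r _ (by omega) (List.mem_cons_self) (by omega)
    · exact mkT (q - r) r (q - (q - r : ℕ)) (by omega) (by omega) (by simp [smallTriple]) (by omega)
    · exact mkT (r - q - 1) r (-(q + 1 + (r - q - 1 : ℕ))) (by omega) (by omega)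
        (by simp [smallTriple]) (by omega)
    · rcases le_or_gt r p with h' | h'
      · exact mkF (p - r) r (p - (p - r : ℕ)) (by omega) (by simp [smallQuintuple]) (by omega)
      · exact mkF (r - p - 1) r (-(p + 1 + (r - p - 1 : ℕ))) (by omega)
          (by simp [smallQuintuple]) (by omega)
    · rcases Nat.even_or_odd' (r - x) with ⟨j, h' | h'⟩
      · exact mkF j r (x + 2 * j) (by omega) (by simp [smallQuintuple]) (by omega)
      · exact mkF j r (-(x + 2 * j + 1)) (by omega) (by simp [smallQuintuple]) (by omega)
    · obtain ⟨L, hL, y, hy, h⟩ := h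
      refine ⟨L, List.mem_cons_of_mem _ (List.mem_append_right _ hL), y, hy, ?_⟩
      rcases h with h | h | h
      · left; simp [h]
      · right; simp [h]
      · left
        rw [h]
        exact ⟨1, by push_cast; ring⟩

theorem exists_isZeroSumPartition {n : ℕ} (hn : 40 ≤ n) :
    ∃ (G : Type) (_ : Fintype G) (s : Option G → ℕ) (R : Option G → ℕ → ℤ),
      IsZeroSumPartition n s R := by
  let pair (q z : ℤ) : List (List ℤ) := [[1, q - 1, -(q + 2), -z, z + 2], [3, q, -(q + 1), z + 1, -(z + 3)]]
  have hn8 := Nat.mod_lt n (show 8 > 0 by norm_num)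
  obtain ⟨a, ha⟩ : ∃ a, a = n / 8 := ⟨_, rfl⟩
  obtain h | h | h | h | h | h | h | h : n = 8 * a ∨ n = 8 * a + 3 ∨ n = 8 * a + 6 ∨ n = 8 * a + 5 ∨
    n = 8 * a + 4 ∨ n = 8 * a + 7 ∨ n = 8 * (a - 1) + 10 ∨ n = 8 * (a - 1) + 9 := by omega
  · refine exists_isZeroSumPartition_of_layout a a (3 * a) (5 * a) (6 * a + 1) 0 [] ?_ ?_ ?_ ?_ ?_ <;>
      (try simp) <;> omega
  · refine exists_isZeroSumPartition_of_layout (a + 1) a (3 * a + 2) (5 * a + 3) (6 * a + 4) 0 []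
      ?_ ?_ ?_ ?_ ?_ <;>
      (try simp) <;> omega
  · refine exists_isZeroSumPartition_of_layout (a + 1) a (3 * a + 3) (5 * a + 4) (6 * a + 6) 0
      [[2 * a + 2, 6 * a + 5, n - (2 * n + 1)]] ?_ ?_ ?_ ?_ ?_ <;>
      (try simp) <;> omega
  · refine exists_isZeroSumPartition_of_layout a a (3 * a + 1) (5 * a + 1) (6 * a + 5) 0
      [[2 * a + 1, 6 * a + 4, n - (2 * n + 1), -(6 * a + 2), 6 * a + 3]] ?_ ?_ ?_ ?_ ?_ <;>
      (try simp) <;> omega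
  · refine exists_isZeroSumPartition_of_layout a a (3 * a) (5 * a) (6 * a + 5) 2
      (pair (3 * a) (6 * a + 1)) ?_ ?_ ?_ ?_ ?_ <;>
      (try simp [pair]) <;> omega
  · refine exists_isZeroSumPartition_of_layout (a + 1) a (3 * a + 2) (5 * a + 3) (6 * a + 8) 2
      (pair (3 * a + 2) (6 * a + 4)) ?_ ?_ ?_ ?_ ?_ <;>
      (try simp [pair]) <;> omega
  · obtain ⟨a, rfl⟩ : ∃ b, a = b + 1 := ⟨a - 1, by omega⟩
    rw [Nat.add_sub_cancel] at h
    refine exists_isZeroSumPartition_of_layout (a + 1) a (3 * a + 3) (5 * a + 4) (6 * a + 10) 2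
      ([2 * a + 2, 6 * a + 9, n - (2 * n + 1)] :: pair (3 * a + 3) (6 * a + 5)) ?_ ?_ ?_ ?_ ?_ <;>
      (try simp [pair]) <;> omega
  · obtain ⟨a, rfl⟩ : ∃ b, a = b + 1 := ⟨a - 1, by omega⟩
    rw [Nat.add_sub_cancel] at h
    refine exists_isZeroSumPartition_of_layout a a (3 * a + 1) (5 * a + 1) (6 * a + 9) 2
      ([2 * a + 1, 6 * a + 8, n - (2 * n + 1), -(6 * a + 6), 6 * a + 7] :: pair (3 * a + 1) (6 * a + 2))
      ?_ ?_ ?_ ?_ ?_ <;>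
      (try simp [pair]) <;> omega

/-- Shifts for the walks attached to zero-sum cycles of lengths `s g`. -/
structure IsShift {G : Type} (k : ℕ) (s : G → ℕ) (t : G → ℕ → ℤ) : Prop where
  periodic : ∀ g c, t g (c + s g) = t g c
  sum_eq : ∀ g, 2 * ∑ c ∈ range (s g), t g c = s g * (s g - 1) - (k - s g)

/-- Lengths of the walks of an assembled system. -/
def systemLength {G κ : Type} (k : ℕ) (s : Option G → ℕ) (ℓ : κ → ℕ) :
    (Σ g : G, Fin (s (some g))) ⊕ κ → ℕ :=
  Sum.elim (fun _ => k) ℓ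

/-- Steps of the walks attached to the non-special zero-sum cycles, followed by those of a family
of special walks. -/
def systemStep {G κ : Type} (v m k : ℕ) (s : Option G → ℕ) (R : Option G → ℕ → ℤ)
    (t : G → ℕ → ℤ) (X Y : κ → ℕ → ℤ) : (Σ g : G, Fin (s (some g))) ⊕ κ → ℕ → ZMod v :=
  Sum.elim (fun p => intStep v m (groupX k (s (some p.1)) (R (some p.1)) p.2)
    (groupY k (s (some p.1)) (t p.1) p.2)) fun i => intStep v m (X i) (Y i)

/-- The index of the walk through a step, for a step in the residue class `c`. -/
def groupWalk (k s c l : ℕ) (hs : 0 < s) : Fin s := ⟨(c + s - (l - (k - s))) % s, Nat.mod_lt _ hs⟩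

theorem groupWalk_eq_iff {k s c l l' : ℕ} (hs : 0 < s) (hsk : s ≤ k) (hl : l < k) (hl' : l' < k) :
    groupWalk k s c l hs = groupWalk k s c l' hs ↔ l - (k - s) = l' - (k - s) := by
  refine ⟨fun h => ?_, fun h => by rw [groupWalk, groupWalk]; simp only [h]⟩
  have h1 : (c + s - (l - (k - s))) ≡ (c + s - (l' - (k - s))) [MOD s] := congrArg Fin.val h
  have h2 := (Nat.modEq_iff_dvd.1 h1)
  have := Int.eq_zero_of_abs_lt_dvd h2 (by rw [abs_lt]; constructor <;> omega)
  omega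

section System

variable {G : Type} [Fintype G] {κ : Type} {k n v : ℕ} {s : Option G → ℕ}
  {R : Option G → ℕ → ℤ} {ℓ : κ → ℕ} {X Y : κ → ℕ → ℤ} {t : G → ℕ → ℤ}

theorem exists_systemStep_eq (h7 : 7 ≤ k) (hv : v = (2 * n + 1) * k) (hP : IsZeroSumPartition n s R)
    (ht : IsShift k (fun g => s (some g)) t) (g : G) (c : ℕ) (y : ℤ) (hs : 0 < s (some g)) :
    letI l := groupPos k (t g c) y
    letI i : (Σ g : G, Fin (s (some g))) ⊕ κ := Sum.inl ⟨g, groupWalk k (s (some g)) c l hs⟩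
    l < systemLength k s ℓ i ∧
    (((R (some g) c + y * (2 * n + 1 : ℕ) : ℤ) : ZMod v) =
      systemStep v (2 * n + 1) k s R t X Y i l ∨
    ((R (some g) c + y * (2 * n + 1 : ℕ) : ℤ) : ZMod v) =
      -systemStep v (2 * n + 1) k s R t X Y i l) :=
  ⟨groupPos_lt (by omega) _ _, group_step hv (by have := hP.length_eq (some g); omega) hs
    (hP.isZeroSumCycle _).periodic (ht.periodic g) y⟩

theorem isWalkSystem_systemStep [Fintype κ] (hk : Odd k) (h7 : 7 ≤ k) (hv : v = (2 * n + 1) * k)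
    (hP : IsZeroSumPartition n s R) (hbase : ∀ i, IsBaseWalk (2 * n + 1) k (ℓ i) (X i) (Y i))
    (htotal : 2 * ∑ i, ℓ i + 1 = 7 * k)
    (hnone : ∀ c < 3, ∀ y : ℤ, Hits k ℓ X Y (R none c) y)
    (hzero : ∀ y : ℤ, ¬(k : ℤ) ∣ y → Hits k ℓ X Y 0 y)
    (ht : IsShift k (fun g => s (some g)) t) :
    IsWalkSystem v k (systemLength k s ℓ) (systemStep v (2 * n + 1) k s R t X Y) := by
  have hits : ∀ r y : ℤ, Hits k ℓ X Y r y → ∃ i, ∃ l < systemLength k s ℓ i,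
      ((r + y * (2 * n + 1 : ℕ) : ℤ) : ZMod v) = systemStep v (2 * n + 1) k s R t X Y i l ∨
      ((r + y * (2 * n + 1 : ℕ) : ℤ) : ZMod v) = -systemStep v (2 * n + 1) k s R t X Y i l := by
    rintro r y ⟨i, l, hl, h⟩
    refine ⟨.inr i, l, hl, h.imp (fun h => ?_) fun h => ?_⟩
    · change _ = (((X i l + Y i l * (2 * n + 1 : ℕ) : ℤ)) : ZMod v)
      rw [h.1]
      exact intCast_add_mul_eq hv h.2
    · change _ = -(((X i l + Y i l * (2 * n + 1 : ℕ) : ℤ)) : ZMod v)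
      rw [h.1, intCast_add_mul_eq hv (y' := -Y i l) (by simpa using h.2), ← Int.cast_neg]
      congr 1
      ring
  have class_mem : ∀ g, ∀ c < s g, ∀ y : ℤ, ∃ i, ∃ l < systemLength k s ℓ i,
      ((R g c + y * (2 * n + 1 : ℕ) : ℤ) : ZMod v) = systemStep v (2 * n + 1) k s R t X Y i l ∨
      ((R g c + y * (2 * n + 1 : ℕ) : ℤ) : ZMod v) = -systemStep v (2 * n + 1) k s R t X Y i l := by
    rintro (_ | g) c hc y
    · exact hits _ _ (hnone c (hP.length_none ▸ hc) y)
    · exact ⟨_, _, exists_systemStep_eq h7 hv hP ht g c y (by omega)⟩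
  refine ⟨?_, ?_, ?_⟩
  · rintro (⟨g, i⟩ | i)
    · have hs := hP.length_eq (some g)
      exact (isBaseWalk_group hk (by rcases hs with h | h <;> rw [h] <;> decide) (by omega)
        (by omega) (hP.isZeroSumCycle _) (ht.periodic g) (ht.sum_eq g) i).isClosedWalk hv (by omega)
    · exact (hbase i).isClosedWalk hv (by omega)
  · intro x hx
    obtain ⟨z, rfl⟩ := ZMod.intCast_surjective x
    by_cases hz : ((2 * n + 1 : ℕ) : ℤ) ∣ z
    · obtain ⟨y, rfl⟩ := hz
      obtain ⟨i, l, hl, h⟩ := hits 0 y (hzero y fun ⟨w, hw⟩ => hx (by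
        rw [ZMod.intCast_zmod_eq_zero_iff_dvd, hv]
        exact ⟨w, by rw [hw]; push_cast; ring⟩))
      rw [zero_add, mul_comm] at h
      exact ⟨i, l, hl, h⟩
    · obtain ⟨g, c, hc, ⟨y, h⟩ | ⟨y, h⟩⟩ := hP.cover z hz
      · obtain ⟨i, l, hl, h'⟩ := class_mem g c hc y
        rw [mul_comm y, ← h, add_sub_cancel] at h'
        exact ⟨i, l, hl, h'⟩
      · obtain ⟨i, l, hl, h'⟩ := class_mem g c hc (-y)
        rw [neg_mul, mul_comm y, ← h, show R g c + -(z + R g c) = -z by ring, Int.cast_neg] at h'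
        refine ⟨i, l, hl, ?_⟩
        rcases h' with h' | h'
        · exact .inr (by rw [← h', neg_neg])
        · exact .inl (neg_injective h')
  · have h1 : ∑ i, systemLength k s ℓ i = (∑ g : G, s (some g)) * k + ∑ i, ℓ i := by
      simp [systemLength, Fintype.sum_sum_type]
    have h2 := hP.sum_length
    rw [Fintype.sum_option, hP.length_none] at h2
    rw [h1, hv, ← h2, mul_add, add_assoc, htotal]
    ring

theorem dvd_sub_of_walkDesign_eq [Fintype κ] {t' : G → ℕ → ℤ} (h7 : 7 ≤ k) (hv : v = (2 * n + 1) * k)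
    (hP : IsZeroSumPartition n s R) (ht : IsShift k (fun g => s (some g)) t)
    (ht' : IsShift k (fun g => s (some g)) t')
    (hS : IsWalkSystem v k (systemLength k s ℓ) (systemStep v (2 * n + 1) k s R t X Y))
    (hS' : IsWalkSystem v k (systemLength k s ℓ) (systemStep v (2 * n + 1) k s R t' X Y))
    (h : walkDesign k (systemLength k s ℓ) (systemStep v (2 * n + 1) k s R t X Y) =
      walkDesign k (systemLength k s ℓ) (systemStep v (2 * n + 1) k s R t' X Y)) (g : G) (c : ℕ) :
    (k : ℤ) ∣ t g c - t' g c := by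
  have hsg := hP.length_eq (some g)
  have hs : 0 < s (some g) := by omega
  have key : ∀ {t : G → ℕ → ℤ} (_ : IsShift k (fun g => s (some g)) t)
      (_ : IsWalkSystem v k (systemLength k s ℓ) (systemStep v (2 * n + 1) k s R t X Y)) (y y' : ℤ),
      Linked (walkDesign k (systemLength k s ℓ) (systemStep v (2 * n + 1) k s R t X Y))
        ((R (some g) c + y * (2 * n + 1 : ℕ) : ℤ) : ZMod v)
        ((R (some g) c + y' * (2 * n + 1 : ℕ) : ℤ) : ZMod v) ↔
      groupPos k (t g c) y - (k - s (some g)) = groupPos k (t g c) y' - (k - s (some g)) := by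
    intro t ht hS y y'
    obtain ⟨hl, h1⟩ := exists_systemStep_eq (X := X) (Y := Y) (ℓ := ℓ) h7 hv hP ht g c y hs
    obtain ⟨hl', h1'⟩ := exists_systemStep_eq (X := X) (Y := Y) (ℓ := ℓ) h7 hv hP ht g c y' hs
    rw [hS.linked_iff (by omega) hl hl' h1 h1', Sum.inl.injEq, Sigma.mk.injEq, heq_eq_eq,
      eq_self, true_and, groupWalk_eq_iff (k := k) hs (by omega) hl hl']
  refine dvd_sub_of_groupPos (s := s (some g)) (by omega) (by omega) fun y y' => ?_
  rw [← key ht hS, ← key ht' hS', h]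

end System

/-- The shift with prescribed values outside the multiples of `s g`. -/
def shiftOf {G : Type} {k : ℕ} (s : G → ℕ) (θ : ∀ g, Fin (s g - 1) → Fin k) (g : G) (c : ℕ) : ℤ :=
  if h : c % s g - 1 < s g - 1 ∧ c % s g ≠ 0 then (θ g ⟨c % s g - 1, h.1⟩ : ℕ)
  else (s g * (s g - 1) - (k - s g)) / 2 - ∑ a, ((θ g a : ℕ) : ℤ)

theorem shiftOf_succ {G : Type} {k : ℕ} {s : G → ℕ} (θ : ∀ g, Fin (s g - 1) → Fin k) (g : G)
    (a : Fin (s g - 1)) : shiftOf s θ g (a + 1) = (θ g a : ℕ) := by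
  have h : ((a : ℕ) + 1) % s g = a + 1 := Nat.mod_eq_of_lt (by omega)
  simp [shiftOf, h]

theorem isShift_shiftOf {G : Type} {k : ℕ} (hk : Odd k) {s : G → ℕ} (hs : ∀ g, Odd (s g))
    (θ : ∀ g, Fin (s g - 1) → Fin k) : IsShift k s (shiftOf s θ) := by
  refine ⟨fun g c => ?_, fun g => ?_⟩
  · simp only [shiftOf, Nat.add_mod_right]
  · obtain ⟨r, hr⟩ : ∃ r, s g = r + 1 := ⟨s g - 1, by have := (hs g).pos; omega⟩
    have h1 : ∑ c ∈ range (s g), shiftOf s θ g c =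
        ∑ a : Fin (s g - 1), shiftOf s θ g (a + 1) + shiftOf s θ g 0 := by
      rw [Fin.sum_univ_eq_sum_range (fun a => shiftOf s θ g (a + 1)),
        ← sum_range_succ' (fun a => shiftOf s θ g a), hr, Nat.add_sub_cancel]
    rw [h1]
    simp only [shiftOf_succ]
    have h2 : shiftOf s θ g 0 =
        (s g * (s g - 1) - (k - s g)) / 2 - ∑ a, ((θ g a : ℕ) : ℤ) := by
      simp [shiftOf]
    rw [h2, add_sub_cancel]
    apply Int.mul_ediv_cancel'
    obtain ⟨a, ha⟩ := hs g
    obtain ⟨b, rfl⟩ := hk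
    rw [ha]
    exact ⟨(2 * a + 1) * a - (b - a), by push_cast; ring⟩

theorem pow_le_mul_NC {n k : ℕ} (hk : Odd k) (h7 : 7 ≤ k) (hn : 40 ≤ n) :
    ∃ e, 2 * (n - 3) ≤ 3 * e ∧ k ^ e ≤ (2 * n + 1) * k * NC (2 * n * k + k) k := by
  obtain ⟨G, _, s, R, hP⟩ := exists_isZeroSumPartition hn
  have hR := hP.isZeroSumCycle none
  rw [hP.length_none] at hR
  obtain ⟨κ, _, ℓ, X, Y, hbase, htotal, hnone, hzero⟩ := exists_special hk h7 hR
  have hv : 2 * n * k + k = (2 * n + 1) * k := by ring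
  have hv0 : NeZero (2 * n * k + k) := ⟨by omega⟩
  have hs : ∀ g : G, Odd (s (some g)) := fun g => by
    rcases hP.length_eq (some g) with h | h <;> rw [h] <;> decide
  have hshift := isShift_shiftOf hk hs
  have hS := fun θ => isWalkSystem_systemStep hk h7 hv hP hbase htotal hnone hzero (hshift θ)
  let F : (∀ g : G, Fin (s (some g) - 1) → Fin k) →
      {B : Set (Block (2 * n * k + k)) // IsCyclicDesign (2 * n * k + k) k B} :=
    fun θ => ⟨_, (hS θ).isCyclicDesign (by omega)⟩
  have hF : Function.Injective F := by
    intro θ θ' h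
    funext g a
    have h1 := dvd_sub_of_walkDesign_eq h7 hv hP (hshift θ) (hshift θ') (hS θ) (hS θ')
      (congrArg Subtype.val h) g (a + 1)
    rw [shiftOf_succ (s := fun g => s (some g)), shiftOf_succ (s := fun g => s (some g))] at h1
    have := Int.eq_zero_of_abs_lt_dvd h1 (by rw [abs_lt]; constructor <;> omega)
    exact Fin.ext (by omega)
  refine ⟨∑ g : G, (s (some g) - 1), ?_, ?_⟩
  · have h2 := hP.sum_length
    rw [Fintype.sum_option, hP.length_none] at h2
    rw [← h2, Nat.add_sub_cancel_left, mul_sum, mul_sum]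
    exact sum_le_sum fun g _ => by have := hP.length_eq (some g); omega
  · have h1 := Nat.card_le_card_of_injective F hF
    rw [Nat.card_pi] at h1
    simp only [Nat.card_eq_fintype_card, Fintype.card_fun, Fintype.card_fin, prod_pow_eq_pow_sum] at h1
    rw [← hv]
    exact h1.trans (card_cyclicDesign_le _ _)

theorem eventually_pow_le : ∃ N : ℕ, ∀ n, N ≤ n →
    (2 * n + 1 : ℝ) ^ 3 * 49 ^ 3 * ((2.49 : ℝ) ^ n) ^ 3 ≤ 49 ^ n := by
  have h := tendsto_pow_const_div_const_pow_of_one_lt 3 (show (1 : ℝ) < 3 by norm_num)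
  obtain ⟨N, hN⟩ := Filter.eventually_atTop.1
    (h.eventually (ge_mem_nhds (show (0 : ℝ) < 1 / (27 * 49 ^ 3) by norm_num)))
  refine ⟨N + 1, fun n hn => ?_⟩
  have h1 := hN n (by omega)
  rw [div_le_div_iff₀ (by positivity) (by positivity)] at h1
  have hn1 : (1 : ℝ) ≤ n := by exact_mod_cast (show 1 ≤ n by omega)
  calc (2 * n + 1 : ℝ) ^ 3 * 49 ^ 3 * ((2.49 : ℝ) ^ n) ^ 3
      ≤ (3 * n : ℝ) ^ 3 * 49 ^ 3 * ((2.49 : ℝ) ^ n) ^ 3 := by gcongr; linarith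
    _ ≤ 3 ^ n * ((2.49 : ℝ) ^ 3) ^ n := by
      rw [pow_right_comm]
      gcongr
      linarith
    _ = (3 * (2.49 : ℝ) ^ 3) ^ n := (mul_pow ..).symm
    _ ≤ 49 ^ n := by gcongr; norm_num

end CCS

/-- There is `N` such that for every odd `k > 5` and every `n ≥ N`
not congruent to `3, 5, 24, 26 (mod 28)`, `NC(2nk+k, k) ≥ 2.49^n / k`. -/
theorem stmt16 : ∃ N : ℕ, ∀ k n : ℕ, Odd k → 5 < k → N ≤ n →
    ¬(n % 28 = 3 ∨ n % 28 = 5 ∨ n % 28 = 24 ∨ n % 28 = 26) →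
    (2.49 : ℝ) ^ n / (k : ℝ) ≤ (CCS.NC (2 * n * k + k) k : ℝ) := by
  obtain ⟨N, hN⟩ := CCS.eventually_pow_le
  refine ⟨N + 40, fun k n hk h5 hn _ => ?_⟩
  have h7 : 7 ≤ k := by obtain ⟨a, rfl⟩ := hk; omega
  obtain ⟨e, he, hcard⟩ := CCS.pow_le_mul_NC hk h7 (show 40 ≤ n by omega)
  have hk0 : (0 : ℝ) < k := by positivity
  have h1 : (2 * n + 1 : ℝ) * 2.49 ^ n ≤ k ^ e := by
    refine le_of_pow_le_pow_left₀ three_ne_zero (by positivity) ?_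
    have h2 := hN n (by omega)
    have h3 : (49 : ℝ) ^ n ≤ 49 ^ 3 * ((k : ℝ) ^ e) ^ 3 := by
      calc (49 : ℝ) ^ n = 49 ^ 3 * 49 ^ (n - 3) := by rw [← pow_add]; congr 1; omega
        _ = 49 ^ 3 * 7 ^ (2 * (n - 3)) := by rw [pow_mul]; norm_num
        _ ≤ 49 ^ 3 * 7 ^ (3 * e) := by gcongr; norm_num
        _ ≤ 49 ^ 3 * k ^ (3 * e) := by gcongr; exact_mod_cast h7
        _ = 49 ^ 3 * ((k : ℝ) ^ e) ^ 3 := by rw [← pow_mul, mul_comm e]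
    rw [mul_pow]
    nlinarith
  have h2 : ((k : ℝ) ^ e) ≤ (2 * n + 1) * k * CCS.NC (2 * n * k + k) k := by exact_mod_cast hcard
  rw [div_le_iff₀ hk0]
  refine le_of_mul_le_mul_left (h1.trans (h2.trans_eq ?_)) (show (0 : ℝ) < 2 * n + 1 by positivity)
  ring
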